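/- Let −1/6 < s < 0. For every sufficiently small ε > 0 there exist b ∈ (1/2,1), b′ ∈ (b−1,0) and C > 0 such that for all N ≥ 1 and all Schwartz functions v₁,…,v₄ on ℝ²: ‖ ( (ξ·m(ξ) / (m(ξ₁)m(ξ₂)m(ξ₃)m(ξ₄))) · 1_{max_{1≤j≤4}|ξ_j| > N} )^∨(v₁,v₂,v₃,v₄) ‖_{X^{0,b′}} ≤ C N^{−1/2+ε} ∏_{j=1}^4 ‖v_j‖_{X^{0,b}}, where ξ = ξ₁+ξ₂+ξ₃+ξ₄. -/

import Mathlib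

open MeasureTheory

noncomputable section

/-- Spacetime Fourier transform on ℝ². -/
def FT2 (u : ℝ × ℝ → ℂ) (τ ξ : ℝ) : ℂ :=
  ∫ p : ℝ × ℝ, Complex.exp (-(Complex.I * ((p.1 * τ + p.2 * ξ : ℝ) : ℂ))) * u p

/-- Bourgain weight ⟨ξ⟩^{2s}⟨τ-ξ³⟩^{2b}, with ⟨x⟩ = (1+x²)^{1/2}. -/
def wgt (s b τ ξ : ℝ) : ℝ := (1 + ξ ^ 2) ^ s * (1 + (τ - ξ ^ 3) ^ 2) ^ b

/-- The Bourgain norm ‖u‖_{X^{s,b}}. -/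
def Xnorm (s b : ℝ) (u : ℝ × ℝ → ℂ) : ℝ :=
  Real.sqrt (∫ q : ℝ × ℝ, wgt s b q.1 q.2 * ‖FT2 u q.1 q.2‖ ^ 2)

/-- Extend `k-1` frequencies to `k` with the last determined by the total `tot`. -/
def padTot (k : ℕ) (tot : ℝ) (v : Fin (k - 1) → ℝ) : Fin k → ℝ :=
  fun j => if h : (j : ℕ) < k - 1 then v ⟨j, h⟩ else tot - ∑ i, v i

/-- Spacetime Fourier transform of M^∨(u₁,…,u_k) at (τ,ξ). -/
def convFT (k : ℕ) (M : (Fin k → ℝ) → ℂ) (u : Fin k → ℝ × ℝ → ℂ) (τ ξ : ℝ) : ℂ :=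
  ∫ q : Fin (k - 1) → ℝ × ℝ,
    M (padTot k ξ fun i => (q i).2) *
      ∏ j, FT2 (u j) (padTot k τ (fun i => (q i).1) j) (padTot k ξ (fun i => (q i).2) j)

/-- The Bourgain norm ‖M^∨(u₁,…,u_k)‖_{X^{s,b}}. -/
def XnormM (s b : ℝ) (k : ℕ) (M : (Fin k → ℝ) → ℂ) (u : Fin k → ℝ × ℝ → ℂ) : ℝ :=
  Real.sqrt (∫ q : ℝ × ℝ, wgt s b q.1 q.2 * ‖convFT k M u q.1 q.2‖ ^ 2)

/-- The I-method multiplier m. -/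
def mI (s N ξ : ℝ) : ℝ := if |ξ| ≤ N then 1 else (|ξ| / N) ^ s

open scoped ENNReal

theorem lintegral_quadratic_le (α x₀ γ : ℝ) (φ : ℝ → ℝ≥0∞) :
    ∫⁻ x, ENNReal.ofReal |2 * α * (x - x₀)| * φ (α * (x - x₀) ^ 2 + γ) ≤ 2 * ∫⁻ x, φ x := by
  by_cases hα : α = 0
  · simp [hα]
  have hd : ∀ s : Set ℝ, ∀ x ∈ s, HasDerivWithinAt (fun x => α * (x - x₀) ^ 2 + γ)
      (2 * α * (x - x₀)) s x := by
    intro s x _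
    have h := ((((hasDerivAt_id' x).sub_const x₀).fun_pow 2).const_mul α).add_const γ
    have e : 2 * α * (x - x₀) = α * ((2 : ℕ) * (x - x₀) ^ (2 - 1) * 1) := by
      norm_num
      ring
    rw [e]
    exact h.hasDerivWithinAt
  have key : ∀ s : Set ℝ, MeasurableSet s →
      (∀ x ∈ s, ∀ y ∈ s, 0 ≤ (x - x₀) * (y - x₀)) →
      ∫⁻ x in s, ENNReal.ofReal |2 * α * (x - x₀)| * φ (α * (x - x₀) ^ 2 + γ)
        ≤ ∫⁻ x, φ x := by
    intro s hs hsgn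
    rw [← lintegral_image_eq_lintegral_abs_deriv_mul hs (hd s)]
    · exact setLIntegral_le_lintegral _ _
    · intro x hx y hy hxy
      have h1 : (x - x₀) ^ 2 = (y - x₀) ^ 2 := by
        simpa [hα] using hxy
      rcases sq_eq_sq_iff_eq_or_eq_neg.1 h1 with h | h
      · linarith
      · have := hsgn x hx y hy
        rw [h] at this
        have h0 : y - x₀ = 0 := by nlinarith
        linarith
  rw [← lintegral_add_compl _ (measurableSet_Iio (a := x₀)), two_mul (∫⁻ x, φ x), Set.compl_Iio]
  refine add_le_add ?_ ?_
  · refine key _ measurableSet_Iio fun x hx y hy => ?_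
    simp only [Set.mem_Iio] at hx hy
    nlinarith
  · refine key _ measurableSet_Ici fun x hx y hy => ?_
    simp only [Set.mem_Ici] at hx hy
    nlinarith

/-- The Japanese bracket power `⟨v⟩^{2β}`, as an extended nonnegative real. -/
def jb (β v : ℝ) : ℝ≥0∞ := ENNReal.ofReal ((1 + v ^ 2) ^ β)

@[fun_prop]
theorem measurable_jb (β : ℝ) : Measurable (jb β) := by
  unfold jb; fun_prop

theorem jb_mul (β γ v : ℝ) : jb β v * jb γ v = jb (β + γ) v := by
  have : 0 < 1 + v ^ 2 := by positivity
  rw [jb, jb, jb, ← ENNReal.ofReal_mul (by positivity), Real.rpow_add this]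

theorem jb_sq (β v : ℝ) : jb (β / 2) v ^ 2 = jb β v := by
  rw [sq, jb_mul, add_halves]



theorem jb_le_one {β : ℝ} (hβ : β ≤ 0) (v : ℝ) : jb β v ≤ 1 := by
  rw [jb, ENNReal.ofReal_le_one]
  exact Real.rpow_le_one_of_one_le_of_nonpos (by nlinarith) hβ

theorem lintegral_jb_lt_top {b : ℝ} (hb : 1 / 2 < b) : ∫⁻ v, jb (-b) v < ∞ := by
  have h := integrable_rpow_neg_one_add_norm_sq (E := ℝ) (μ := volume) (r := 2 * b)
    (by simp; linarith)
  have h2 := h.lintegral_lt_top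
  convert h2 using 4 with v
  rw [Real.norm_eq_abs, sq_abs]
  congr 1
  ring

theorem jb_le_add {b b' M : ℝ} (hb' : b' ≤ 0) (hbb : 0 ≤ b + b') (hM : 1 ≤ M) (v : ℝ) :
    jb b' v ≤ ENNReal.ofReal (M ^ (6 * b')) +
      ENNReal.ofReal (M ^ (6 * (b + b'))) * jb (-b) v := by
  have hM0 : 0 < M := by linarith
  have ht : 0 < 1 + v ^ 2 := by positivity
  unfold jb
  rw [← ENNReal.ofReal_mul (by positivity), ← ENNReal.ofReal_add (by positivity) (by positivity)]
  apply ENNReal.ofReal_le_ofReal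
  have e : ∀ x : ℝ, M ^ (6 * x) = (M ^ (6:ℝ)) ^ x := fun x => Real.rpow_mul hM0.le _ _
  rw [e, e]
  have hM6 : 0 < M ^ (6:ℝ) := by positivity
  rcases le_total (M ^ (6:ℝ)) (1 + v ^ 2) with h | h
  · have := Real.rpow_le_rpow_of_nonpos hM6 h hb'
    have : 0 ≤ (M ^ (6:ℝ)) ^ (b + b') * (1 + v ^ 2) ^ (-b) := by positivity
    linarith
  · have h1 := Real.rpow_le_rpow ht.le h hbb
    have h2 : (1 + v ^ 2) ^ b' = (1 + v ^ 2) ^ (b + b') * (1 + v ^ 2) ^ (-b) := by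
      rw [← Real.rpow_add ht]; ring_nf
    have h3 := mul_le_mul_of_nonneg_right h1 (Real.rpow_nonneg ht.le (-b))
    have : 0 ≤ (M ^ (6:ℝ)) ^ b' := by positivity
    linarith

/-- Integration in the coordinates `(τ - ξ³, ξ)`. -/
theorem lintegral_prod_shear {f : ℝ × ℝ → ℝ≥0∞} (hf : Measurable f) :
    ∫⁻ q, f q = ∫⁻ σ, ∫⁻ ξ, f (σ + ξ ^ 3, ξ) := by
  rw [Measure.volume_eq_prod, lintegral_prod_symm' _ hf]
  have : ∀ y : ℝ, ∫⁻ x, f (x, y) = ∫⁻ x, f (x + y ^ 3, y) := fun y =>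
    (lintegral_add_right_eq_self (fun x => f (x, y)) (y ^ 3)).symm
  simp_rw [this]
  rw [lintegral_lintegral_swap]
  exact (hf.comp (by fun_prop : Measurable fun z : ℝ × ℝ => (z.2 + z.1 ^ 3, z.1))).aemeasurable

theorem setLIntegral_abs_rpow_le {δ A : ℝ} (hδ : 0 < δ) (hA : 0 ≤ A) :
    ∫⁻ y in Set.Icc (-A) A, ENNReal.ofReal (|y| ^ (δ - 1)) ≤ ENNReal.ofReal (2 * A ^ δ / δ) := by
  have hpos : ∫⁻ y in Set.Icc 0 A, ENNReal.ofReal (|y| ^ (δ - 1)) = ENNReal.ofReal (A ^ δ / δ) := by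
    have hi : IntegrableOn (fun y : ℝ => y ^ (δ - 1)) (Set.Ioc 0 A) := by
      have := intervalIntegral.intervalIntegrable_rpow' (a := 0) (b := A) (r := δ - 1) (by linarith)
      exact (intervalIntegrable_iff_integrableOn_Ioc_of_le hA).1 this
    have hv : ∫ y in Set.Ioc 0 A, y ^ (δ - 1) = A ^ δ / δ := by
      rw [← intervalIntegral.integral_of_le hA, integral_rpow (Or.inl (by linarith))]
      simp [hδ.ne']
    rw [setLIntegral_congr Ioc_ae_eq_Icc.symm, ← hv, ofReal_integral_eq_lintegral_ofReal hi]
    · refine setLIntegral_congr_fun measurableSet_Ioc fun y hy => ?_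
      simp only [abs_of_pos hy.1]
    · filter_upwards [ae_restrict_mem measurableSet_Ioc] with y hy
      exact Real.rpow_nonneg hy.1.le _
  have hneg : ∫⁻ y in Set.Icc (-A) 0, ENNReal.ofReal (|y| ^ (δ - 1)) =
      ENNReal.ofReal (A ^ δ / δ) := by
    rw [← hpos, ← lintegral_indicator measurableSet_Icc, ← lintegral_indicator measurableSet_Icc,
      ← lintegral_neg_eq_self]
    congr 1 with y
    simp only [Set.indicator, Set.mem_Icc, abs_neg]
    congr 1
    apply propext
    constructor <;> rintro ⟨h1, h2⟩ <;> constructor <;> linarith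
  calc _ ≤ ∫⁻ y in Set.Icc (-A) 0 ∪ Set.Icc 0 A, ENNReal.ofReal (|y| ^ (δ - 1)) := by
        apply lintegral_mono_set
        intro y hy
        rcases le_total y 0 with h | h
        · exact Or.inl ⟨hy.1, h⟩
        · exact Or.inr ⟨h, hy.2⟩
    _ ≤ _ := lintegral_union_le _ _ _
    _ = _ := by
        rw [hpos, hneg, ← ENNReal.ofReal_add (by positivity) (by positivity)]
        congr 1
        ring

/-- Indicator of the frequencies `x`, `p + x` being transversal at scale `M`. -/
def transKer (M p x : ℝ) : ℝ≥0∞ :=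
  if |x| ≤ M ∧ M ^ 2 / 400 ≤ |(p + x) ^ 2 - x ^ 2| then 1 else 0

/-- Indicator of a region of frequency triples at scale `M` on which `l³ + i³ + j³` is
non-degenerate in the variable `i - j`, relative to the distance of `l` from `θ (l + i + j)`. -/
def tripleKer (θ M l i j : ℝ) : ℝ≥0∞ :=
  if |l| ≤ M ∧ |i| ≤ M ∧ |j| ≤ M ∧ M / 400 * |l - θ * (l + i + j)| ≤ |i ^ 2 - j ^ 2| then 1 else 0

theorem measurable_transKer (M : ℝ) : Measurable fun z : ℝ × ℝ => transKer M z.1 z.2 := by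
  unfold transKer
  refine Measurable.ite ?_ measurable_const measurable_const
  have h1 : MeasurableSet {z : ℝ × ℝ | |z.2| ≤ M} := measurableSet_le (by fun_prop) (by fun_prop)
  have h2 : MeasurableSet {z : ℝ × ℝ | M ^ 2 / 400 ≤ |(z.1 + z.2) ^ 2 - z.2 ^ 2|} :=
    measurableSet_le (by fun_prop) (by fun_prop)
  exact h1.inter h2

theorem measurable_tripleKer (θ M : ℝ) :
    Measurable fun z : ℝ × ℝ × ℝ => tripleKer θ M z.1 z.2.1 z.2.2 := by
  unfold tripleKer
  refine Measurable.ite ?_ measurable_const measurable_const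
  have h1 : MeasurableSet {z : ℝ × ℝ × ℝ | |z.1| ≤ M} :=
    measurableSet_le (by fun_prop) (by fun_prop)
  have h2 : MeasurableSet {z : ℝ × ℝ × ℝ | |z.2.1| ≤ M} :=
    measurableSet_le (by fun_prop) (by fun_prop)
  have h3 : MeasurableSet {z : ℝ × ℝ × ℝ | |z.2.2| ≤ M} :=
    measurableSet_le (by fun_prop) (by fun_prop)
  have h4 : MeasurableSet {z : ℝ × ℝ × ℝ |
      M / 400 * |z.1 - θ * (z.1 + z.2.1 + z.2.2)| ≤ |z.2.1 ^ 2 - z.2.2 ^ 2|} :=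
    measurableSet_le (by fun_prop) (by fun_prop)
  exact h1.inter (h2.inter (h3.inter h4))

theorem Measurable.transKer {α : Type*} [MeasurableSpace α] {M : ℝ} {f g : α → ℝ}
    (hf : Measurable f) (hg : Measurable g) : Measurable fun a => transKer M (f a) (g a) :=
  (measurable_transKer M).comp (hf.prodMk hg)

theorem Measurable.tripleKer {α : Type*} [MeasurableSpace α] {θ M : ℝ} {f g h : α → ℝ}
    (hf : Measurable f) (hg : Measurable g) (hh : Measurable h) :
    Measurable fun a => tripleKer θ M (f a) (g a) (h a) :=
  (measurable_tripleKer θ M).comp (hf.prodMk (hg.prodMk hh))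

theorem transKer_sq (M p x : ℝ) : transKer M p x ^ 2 = transKer M p x := by
  unfold transKer; split_ifs <;> simp

theorem tripleKer_sq (θ M l i j : ℝ) : tripleKer θ M l i j ^ 2 = tripleKer θ M l i j := by
  unfold tripleKer; split_ifs <;> simp

theorem volume_abs_le (M : ℝ) : volume {x : ℝ | |x| ≤ M} = ENNReal.ofReal (2 * M) := by
  have : {x : ℝ | |x| ≤ M} = Set.Icc (-M) M := by ext x; simp [abs_le]
  rw [this, Real.volume_Icc]
  congr 1
  ring

theorem lintegral_ite_abs_le (M : ℝ) :
    ∫⁻ x : ℝ, (if |x| ≤ M then (1 : ℝ≥0∞) else 0) = ENNReal.ofReal (2 * M) := by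
  rw [← volume_abs_le, ← lintegral_indicator_one (measurableSet_le (by fun_prop) (by fun_prop))]
  rfl

theorem lintegral_transKer_le {b b' M : ℝ} (hb : 1 / 2 < b) (hb' : b' ≤ 0) (hbb : 0 ≤ b + b')
    (hM : 1 ≤ M) (p c : ℝ) :
    ∫⁻ x, transKer M p x * jb b' (c + x ^ 3 - (p + x) ^ 3) ≤
      ENNReal.ofReal (M ^ (-2 + 6 * (b + b'))) * (2 + 300 * ∫⁻ v, jb (-b) v) := by
  have hM0 : 0 < M := by linarith
  have hq := lintegral_quadratic_le (-3 * p) (-p / 2) (-p ^ 3 / 4 + c) (jb (-b))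
  have e1 : ENNReal.ofReal (M ^ (6 * b')) * ENNReal.ofReal (2 * M) ≤
      ENNReal.ofReal (M ^ (-2 + 6 * (b + b'))) * 2 := by
    have h2 : (2 : ℝ≥0∞) = ENNReal.ofReal 2 := by simp
    rw [h2, ← ENNReal.ofReal_mul (by positivity), ← ENNReal.ofReal_mul (by positivity)]
    apply ENNReal.ofReal_le_ofReal
    have : M ^ (6 * b') * (2 * M) = M ^ (6 * b' + 1) * 2 := by
      rw [Real.rpow_add hM0, Real.rpow_one]; ring
    rw [this]
    have := Real.rpow_le_rpow_of_exponent_le hM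
      (by linarith : 6 * b' + 1 ≤ -2 + 6 * (b + b'))
    gcongr
  have e2 : ENNReal.ofReal (M ^ (6 * (b + b'))) * ENNReal.ofReal (400 / (3 * M ^ 2)) * 2 ≤
      ENNReal.ofReal (M ^ (-2 + 6 * (b + b'))) * 300 := by
    have h2 : (2 : ℝ≥0∞) = ENNReal.ofReal 2 := by simp
    have h3 : (300 : ℝ≥0∞) = ENNReal.ofReal 300 := by simp
    rw [h2, h3, ← ENNReal.ofReal_mul (by positivity), ← ENNReal.ofReal_mul (by positivity),
      ← ENNReal.ofReal_mul (by positivity)]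
    apply ENNReal.ofReal_le_ofReal
    rw [Real.rpow_add hM0, show M ^ (-2 : ℝ) = (M ^ 2)⁻¹ by
      rw [Real.rpow_neg hM0.le]; norm_cast]
    have : 0 ≤ M ^ (6 * (b + b')) * (M ^ 2)⁻¹ := by positivity
    calc M ^ (6 * (b + b')) * (400 / (3 * M ^ 2)) * 2
        = M ^ (6 * (b + b')) * (M ^ 2)⁻¹ * (800 / 3) := by field_simp; norm_num
      _ ≤ M ^ (6 * (b + b')) * (M ^ 2)⁻¹ * 300 := by gcongr; norm_num
      _ = _ := by ring
  have hpt : ∀ x, transKer M p x * jb b' (c + x ^ 3 - (p + x) ^ 3) ≤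
      ENNReal.ofReal (M ^ (6 * b')) * (if |x| ≤ M then (1 : ℝ≥0∞) else 0) +
      ENNReal.ofReal (M ^ (6 * (b + b'))) * ENNReal.ofReal (400 / (3 * M ^ 2)) *
      (ENNReal.ofReal |2 * (-3 * p) * (x - -p / 2)| *
        jb (-b) (-3 * p * (x - -p / 2) ^ 2 + (-p ^ 3 / 4 + c))) := by
    intro x
    unfold transKer
    split_ifs with h1 h2 h2
    · have harg : -3 * p * (x - -p / 2) ^ 2 + (-p ^ 3 / 4 + c) = c + x ^ 3 - (p + x) ^ 3 := by
        ring
      have hder : 1 ≤ ENNReal.ofReal (400 / (3 * M ^ 2)) *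
          ENNReal.ofReal |2 * (-3 * p) * (x - -p / 2)| := by
        have : 2 * (-3 * p) * (x - -p / 2) = -(3 * ((p + x) ^ 2 - x ^ 2)) := by ring
        rw [this, abs_neg, abs_mul, ← ENNReal.ofReal_mul (by positivity), ENNReal.one_le_ofReal,
          abs_of_pos (by norm_num : (0 : ℝ) < 3)]
        calc (1 : ℝ) = 400 / (3 * M ^ 2) * (3 * (M ^ 2 / 400)) := by field_simp
          _ ≤ _ := by gcongr; exact h1.2
      rw [harg, one_mul, mul_one]
      refine (jb_le_add hb' hbb hM _).trans (add_le_add le_rfl ?_)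
      have := mul_le_mul' (mul_le_mul' (le_refl (ENNReal.ofReal (M ^ (6 * (b + b'))))) hder)
        (le_refl (jb (-b) (c + x ^ 3 - (p + x) ^ 3)))
      rw [mul_one] at this
      refine this.trans_eq ?_
      simp only [mul_assoc]
    · exact absurd h1.1 h2
    · simp
    · simp
  calc _ ≤ _ := lintegral_mono hpt
    _ = ENNReal.ofReal (M ^ (6 * b')) * ENNReal.ofReal (2 * M) +
        ENNReal.ofReal (M ^ (6 * (b + b'))) * ENNReal.ofReal (400 / (3 * M ^ 2)) *
        ∫⁻ x, (ENNReal.ofReal |2 * (-3 * p) * (x - -p / 2)| *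
        jb (-b) (-3 * p * (x - -p / 2) ^ 2 + (-p ^ 3 / 4 + c))) := by
        rw [lintegral_add_left, lintegral_const_mul, lintegral_const_mul, lintegral_ite_abs_le]
        · fun_prop
        · exact Measurable.ite (measurableSet_le (by fun_prop) (by fun_prop)) measurable_const
            measurable_const
        · exact (Measurable.ite (measurableSet_le (by fun_prop) (by fun_prop)) measurable_const
            measurable_const).const_mul _
    _ ≤ ENNReal.ofReal (M ^ (-2 + 6 * (b + b'))) * 2 +
        ENNReal.ofReal (M ^ (6 * (b + b'))) * ENNReal.ofReal (400 / (3 * M ^ 2)) *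
        (2 * ∫⁻ v, jb (-b) v) := by gcongr
    _ = ENNReal.ofReal (M ^ (-2 + 6 * (b + b'))) * 2 +
        ENNReal.ofReal (M ^ (6 * (b + b'))) * ENNReal.ofReal (400 / (3 * M ^ 2)) * 2 *
        ∫⁻ v, jb (-b) v := by ring
    _ ≤ ENNReal.ofReal (M ^ (-2 + 6 * (b + b'))) * 2 +
        ENNReal.ofReal (M ^ (-2 + 6 * (b + b'))) * 300 * ∫⁻ v, jb (-b) v := by gcongr
    _ = _ := by ring

theorem lintegral_tripleKer_inner_le {b δ θ M : ℝ} (hb : 1 / 2 < b) (hδ : 0 < δ) (hδ1 : δ < 1)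
    (hθ : |θ| ≤ 1) (hM : 1 ≤ M) (p c l : ℝ) (hl : l - θ * p ≠ 0) :
    ∫⁻ x, tripleKer θ M l x (p - l - x) * jb (-b) (c - l ^ 3 - x ^ 3 - (p - l - x) ^ 3) ≤
      ENNReal.ofReal (2 * (300 * (∫⁻ v, jb (-b) v).toReal) ^ (1 - δ) * M ^ (2 * δ - 1)) *
      (Set.Icc (-(4 * M)) (4 * M)).indicator (fun y => ENNReal.ofReal (|y| ^ (δ - 1)))
        (l - θ * p) := by
  have hM0 : 0 < M := by linarith
  by_cases hy : l - θ * p ∈ Set.Icc (-(4 * M)) (4 * M)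
  swap
  · rw [Set.indicator_of_notMem hy, mul_zero, nonpos_iff_eq_zero]
    rw [lintegral_eq_zero_of_ae_eq_zero]
    refine Filter.Eventually.of_forall fun x => ?_
    simp only [Pi.zero_apply, mul_eq_zero]
    left
    unfold tripleKer
    rw [if_neg]
    rintro ⟨h1, h2, h3, -⟩
    apply hy
    rw [Set.mem_Icc, ← abs_le]
    have hp : |p| ≤ 3 * M := by
      have : p = l + x + (p - l - x) := by ring
      rw [this]
      linarith [abs_add_three l x (p - l - x)]
    have : |θ * p| ≤ 3 * M := by
      rw [abs_mul]
      nlinarith [abs_nonneg p, abs_nonneg θ]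
    linarith [abs_sub l (θ * p)]
  rw [Set.indicator_of_mem hy]
  have hypos : 0 < |l - θ * p| := abs_pos.2 hl
  set y := |l - θ * p| with hydef
  set I := ∫⁻ x, tripleKer θ M l x (p - l - x) * jb (-b) (c - l ^ 3 - x ^ 3 - (p - l - x) ^ 3)
    with hI
  have hΦ := lintegral_jb_lt_top hb
  have b1 : I ≤ ENNReal.ofReal (2 * M) := by
    rw [← lintegral_ite_abs_le]
    refine lintegral_mono fun x => ?_
    have h1 := jb_le_one (by linarith : -b ≤ 0) (c - l ^ 3 - x ^ 3 - (p - l - x) ^ 3)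
    unfold tripleKer
    split_ifs with h2 h3 h3
    · simpa using h1
    · exact absurd h2.2.1 h3
    · simp
    · simp
  have b2 : ENNReal.ofReal (M / 400 * (3 * y)) * I ≤ 2 * ∫⁻ v, jb (-b) v := by
    have hq := lintegral_quadratic_le (-3 * (p - l)) ((p - l) / 2) (-(p - l) ^ 3 / 4 + (c - l ^ 3))
      (jb (-b))
    refine le_trans ?_ hq
    rw [hI, ← lintegral_const_mul' _ _ ENNReal.ofReal_ne_top]
    refine lintegral_mono fun x => ?_
    have harg : -3 * (p - l) * (x - (p - l) / 2) ^ 2 + (-(p - l) ^ 3 / 4 + (c - l ^ 3)) =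
        c - l ^ 3 - x ^ 3 - (p - l - x) ^ 3 := by ring
    simp only
    rw [harg, ← mul_assoc]
    gcongr
    unfold tripleKer
    split_ifs with h
    · rw [mul_one]
      apply ENNReal.ofReal_le_ofReal
      have h4 := h.2.2.2
      have : 2 * (-3 * (p - l)) * (x - (p - l) / 2) = -(3 * (x ^ 2 - (p - l - x) ^ 2)) := by ring
      rw [this, abs_neg, abs_mul, abs_of_pos (by norm_num : (0 : ℝ) < 3)]
      have e : l + x + (p - l - x) = p := by ring
      rw [e] at h4
      linarith
    · simp
  have hIfin : I ≠ ∞ := (b1.trans_lt ENNReal.ofReal_lt_top).ne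
  set D := (∫⁻ v, jb (-b) v).toReal with hD
  have hD0 : 0 ≤ D := ENNReal.toReal_nonneg
  have hΦD : ∫⁻ v, jb (-b) v = ENNReal.ofReal D := (ENNReal.ofReal_toReal hΦ.ne).symm
  set r := I.toReal with hr
  have hr0 : 0 ≤ r := ENNReal.toReal_nonneg
  have hIr : I = ENNReal.ofReal r := (ENNReal.ofReal_toReal hIfin).symm
  rw [hIr, ENNReal.ofReal_le_ofReal_iff (by positivity)] at b1
  rw [hIr, hΦD, show (2 : ℝ≥0∞) = ENNReal.ofReal 2 by simp,
    ← ENNReal.ofReal_mul (by positivity), ← ENNReal.ofReal_mul (by positivity),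
    ENNReal.ofReal_le_ofReal_iff (by positivity)] at b2
  rw [hIr, ← ENNReal.ofReal_mul (by positivity)]
  apply ENNReal.ofReal_le_ofReal
  have b3 : r ≤ 300 * D / (M * y) := by
    rw [le_div_iff₀ (by positivity)]
    nlinarith
  have hsplit : r = r ^ δ * r ^ (1 - δ) := by
    rw [← Real.rpow_add_of_nonneg hr0 hδ.le (by linarith)]
    simp
  calc r = r ^ δ * r ^ (1 - δ) := hsplit
    _ ≤ (2 * M) ^ δ * (300 * D / (M * y)) ^ (1 - δ) := by
        gcongr
    _ = 2 ^ δ * (300 * D) ^ (1 - δ) * M ^ (2 * δ - 1) * y ^ (δ - 1) := by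
        rw [Real.mul_rpow (by norm_num) hM0.le, Real.div_rpow (by positivity) (by positivity),
          Real.mul_rpow hM0.le hypos.le, show 2 * δ - 1 = δ + -(1 - δ) by ring,
          Real.rpow_add hM0, show δ - 1 = -(1 - δ) by ring, Real.rpow_neg hM0.le,
          Real.rpow_neg hypos.le]
        field_simp
    _ ≤ 2 * (300 * D) ^ (1 - δ) * M ^ (2 * δ - 1) * y ^ (δ - 1) := by
        gcongr
        calc (2 : ℝ) ^ δ ≤ 2 ^ (1 : ℝ) := by gcongr; norm_num
          _ = 2 := by simp

theorem lintegral_tripleKer_le {b δ θ M : ℝ} (hb : 1 / 2 < b) (hδ : 0 < δ) (hδ1 : δ < 1)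
    (hθ : |θ| ≤ 1) (hM : 1 ≤ M) (p c : ℝ) :
    ∫⁻ l, ∫⁻ x, tripleKer θ M l x (p - l - x) *
        jb (-b) (c - l ^ 3 - x ^ 3 - (p - l - x) ^ 3) ≤
      ENNReal.ofReal (M ^ (-1 + 3 * δ)) *
      ENNReal.ofReal (16 * (300 * (∫⁻ v, jb (-b) v).toReal) ^ (1 - δ) / δ) := by
  have hM0 : 0 < M := by linarith
  set D := (∫⁻ v, jb (-b) v).toReal with hD
  have hD0 : 0 ≤ D := ENNReal.toReal_nonneg
  have hae : ∀ᵐ l : ℝ, l - θ * p ≠ 0 := by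
    have : ∀ᵐ l : ℝ, l ≠ θ * p := Measure.ae_ne volume (θ * p)
    filter_upwards [this] with l hl using sub_ne_zero.2 hl
  calc _ ≤ ∫⁻ l, ENNReal.ofReal (2 * (300 * D) ^ (1 - δ) * M ^ (2 * δ - 1)) *
      (Set.Icc (-(4 * M)) (4 * M)).indicator (fun y => ENNReal.ofReal (|y| ^ (δ - 1)))
        (l - θ * p) := by
        apply lintegral_mono_ae
        filter_upwards [hae] with l hl
        exact lintegral_tripleKer_inner_le hb hδ hδ1 hθ hM p c l hl
    _ = ENNReal.ofReal (2 * (300 * D) ^ (1 - δ) * M ^ (2 * δ - 1)) *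
        ∫⁻ y in Set.Icc (-(4 * M)) (4 * M), ENNReal.ofReal (|y| ^ (δ - 1)) := by
        rw [lintegral_const_mul' _ _ ENNReal.ofReal_ne_top, lintegral_sub_right_eq_self
          (fun y => (Set.Icc (-(4 * M)) (4 * M)).indicator
            (fun y => ENNReal.ofReal (|y| ^ (δ - 1))) y), lintegral_indicator measurableSet_Icc]
    _ ≤ ENNReal.ofReal (2 * (300 * D) ^ (1 - δ) * M ^ (2 * δ - 1)) *
        ENNReal.ofReal (2 * (4 * M) ^ δ / δ) := by
        gcongr
        exact setLIntegral_abs_rpow_le hδ (by positivity)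
    _ ≤ _ := by
        rw [← ENNReal.ofReal_mul (by positivity), ← ENNReal.ofReal_mul (by positivity)]
        apply ENNReal.ofReal_le_ofReal
        have h4 : (4 : ℝ) ^ δ ≤ 4 := by
          calc (4 : ℝ) ^ δ ≤ 4 ^ (1 : ℝ) := by gcongr; norm_num
            _ = 4 := by simp
        rw [Real.mul_rpow (by norm_num) hM0.le, show -1 + 3 * δ = (2 * δ - 1) + δ by ring,
          Real.rpow_add hM0]
        calc _ = 4 * (300 * D) ^ (1 - δ) * M ^ (2 * δ - 1) * M ^ δ / δ * 4 ^ δ := by ring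
          _ ≤ 4 * (300 * D) ^ (1 - δ) * M ^ (2 * δ - 1) * M ^ δ / δ * 4 := by gcongr
          _ = _ := by ring

/-- The weight `⟨τ - ξ³⟩^{2β}` at `q = (τ, ξ)`. -/
def airyWt (β : ℝ) (q : ℝ × ℝ) : ℝ≥0∞ := jb β (q.1 - q.2 ^ 3)

@[fun_prop]
theorem measurable_airyWt (β : ℝ) : Measurable (airyWt β) := by
  unfold airyWt; fun_prop

theorem airyWt_sq (β : ℝ) (q : ℝ × ℝ) : airyWt (β / 2) q ^ 2 = airyWt β q := jb_sq _ _

theorem exists_trans_sup_le {b b' : ℝ} (hb : 1 / 2 < b) (hb' : b' ≤ 0) (hbb : 0 ≤ b + b') :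
    ∃ C : ℝ≥0∞, C ≠ ∞ ∧ ∀ M : ℝ, 1 ≤ M → ∀ P : ℝ × ℝ,
      ∫⁻ q : ℝ × ℝ, transKer M P.2 q.2 * (airyWt b' (q + P) * airyWt (-b) q) ≤
        ENNReal.ofReal (M ^ (-2 + 6 * (b + b'))) * C := by
  have hΦ := lintegral_jb_lt_top hb
  refine ⟨(2 + 300 * ∫⁻ v, jb (-b) v) * ∫⁻ v, jb (-b) v, ?_, fun M hM P => ?_⟩
  · exact ENNReal.mul_ne_top (ENNReal.add_ne_top.2
      ⟨by simp, ENNReal.mul_ne_top (by simp) hΦ.ne⟩) hΦ.ne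
  rw [lintegral_prod_shear]
  · calc _ = ∫⁻ σ, jb (-b) σ * ∫⁻ ξ, transKer M P.2 ξ *
          jb b' ((σ + P.1) + ξ ^ 3 - (P.2 + ξ) ^ 3) := by
          refine lintegral_congr fun σ => ?_
          rw [← lintegral_const_mul]
          · refine lintegral_congr fun ξ => ?_
            simp only [airyWt, Prod.fst_add, Prod.snd_add, add_sub_cancel_right]
            rw [show σ + ξ ^ 3 + P.1 - (ξ + P.2) ^ 3 = (σ + P.1) + ξ ^ 3 - (P.2 + ξ) ^ 3 by ring]
            ring
          · exact (measurable_const.transKer measurable_id).mul (by fun_prop)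
      _ ≤ ∫⁻ σ, jb (-b) σ * (ENNReal.ofReal (M ^ (-2 + 6 * (b + b'))) *
          (2 + 300 * ∫⁻ v, jb (-b) v)) := by
          gcongr with σ
          exact lintegral_transKer_le hb hb' hbb hM _ _
      _ = _ := by
          rw [lintegral_mul_const _ (by fun_prop)]
          ring
  · exact (measurable_const.transKer measurable_snd).mul (by fun_prop)

theorem exists_triple_sup_le {b δ : ℝ} (hb : 1 / 2 < b) (hδ : 0 < δ) (hδ1 : δ < 1) :
    ∃ C : ℝ≥0∞, C ≠ ∞ ∧ ∀ M θ : ℝ, 1 ≤ M → |θ| ≤ 1 → ∀ P : ℝ × ℝ,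
      ∫⁻ l : ℝ × ℝ, ∫⁻ i : ℝ × ℝ, tripleKer θ M l.2 i.2 (P - l - i).2 *
        (airyWt (-b) l * airyWt (-b) i * airyWt (-b) (P - l - i)) ≤
        ENNReal.ofReal (M ^ (-1 + 3 * δ)) * C := by
  have hΦ := lintegral_jb_lt_top hb
  refine ⟨ENNReal.ofReal (16 * (300 * (∫⁻ v, jb (-b) v).toReal) ^ (1 - δ) / δ) *
    (∫⁻ v, jb (-b) v) * ∫⁻ v, jb (-b) v, ?_, fun M θ hM hθ P => ?_⟩
  · exact ENNReal.mul_ne_top (ENNReal.mul_ne_top ENNReal.ofReal_ne_top hΦ.ne) hΦ.ne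
  have hm : Measurable fun z : (ℝ × ℝ) × (ℝ × ℝ) =>
      tripleKer θ M z.1.2 z.2.2 (P - z.1 - z.2).2 *
        (airyWt (-b) z.1 * airyWt (-b) z.2 * airyWt (-b) (P - z.1 - z.2)) := by
    refine Measurable.mul (Measurable.tripleKer ?_ ?_ ?_) ?_ <;> fun_prop
  have hm2 : ∀ σ τ : ℝ, Measurable fun z : ℝ × ℝ => tripleKer θ M z.1 z.2 (P.2 - z.1 - z.2) *
      jb (-b) ((P.1 - σ - τ) - z.1 ^ 3 - z.2 ^ 3 - (P.2 - z.1 - z.2) ^ 3) := by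
    intro σ τ
    refine Measurable.mul (Measurable.tripleKer ?_ ?_ ?_) ?_ <;> fun_prop
  have hm3 : ∀ σ : ℝ, Measurable fun z : ℝ × ℝ × ℝ =>
      tripleKer θ M z.1 z.2.2 (P.2 - z.1 - z.2.2) *
      jb (-b) ((P.1 - σ - z.2.1) - z.1 ^ 3 - z.2.2 ^ 3 - (P.2 - z.1 - z.2.2) ^ 3) := by
    intro σ
    refine Measurable.mul (Measurable.tripleKer ?_ ?_ ?_) ?_ <;> fun_prop
  rw [lintegral_prod_shear hm.lintegral_prod_right']
  calc _ = ∫⁻ σ, jb (-b) σ * ∫⁻ τ, jb (-b) τ * ∫⁻ l, ∫⁻ x,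
        tripleKer θ M l x (P.2 - l - x) *
          jb (-b) ((P.1 - σ - τ) - l ^ 3 - x ^ 3 - (P.2 - l - x) ^ 3) := by
        refine lintegral_congr fun σ => ?_
        have h1 : ∀ l : ℝ, (∫⁻ i : ℝ × ℝ, tripleKer θ M l i.2 (P - (σ + l ^ 3, l) - i).2 *
            (airyWt (-b) (σ + l ^ 3, l) * airyWt (-b) i * airyWt (-b) (P - (σ + l ^ 3, l) - i))) =
            jb (-b) σ * ∫⁻ τ, jb (-b) τ * ∫⁻ x, tripleKer θ M l x (P.2 - l - x) *
          jb (-b) ((P.1 - σ - τ) - l ^ 3 - x ^ 3 - (P.2 - l - x) ^ 3) := by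
          intro l
          rw [lintegral_prod_shear]
          · rw [← lintegral_const_mul' _ _ (by simp [jb])]
            refine lintegral_congr fun τ => ?_
            rw [← mul_assoc, ← lintegral_const_mul]
            · refine lintegral_congr fun x => ?_
              simp only [airyWt, Prod.fst_sub, Prod.snd_sub, add_sub_cancel_right]
              rw [show P.1 - (σ + l ^ 3) - (τ + x ^ 3) - (P.2 - l - x) ^ 3 =
                (P.1 - σ - τ) - l ^ 3 - x ^ 3 - (P.2 - l - x) ^ 3 by ring]
              ring
            · exact (hm2 σ τ).comp (measurable_const.prodMk measurable_id)
          · exact hm.comp (by fun_prop : Measurable fun i : ℝ × ℝ => ((σ + l ^ 3, l), i))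
        simp only [h1]
        rw [lintegral_const_mul' _ _ (by simp [jb])]
        congr 1
        rw [lintegral_lintegral_swap]
        · refine lintegral_congr fun τ => ?_
          rw [lintegral_const_mul' _ _ (by simp [jb])]
        · refine Measurable.aemeasurable ?_
          refine Measurable.mul (by fun_prop) ?_
          have h4 : Measurable fun w : (ℝ × ℝ) × ℝ => tripleKer θ M w.1.1 w.2 (P.2 - w.1.1 - w.2) *
            jb (-b) ((P.1 - σ - w.1.2) - w.1.1 ^ 3 - w.2 ^ 3 - (P.2 - w.1.1 - w.2) ^ 3) :=
            (hm3 σ).comp (by fun_prop : Measurable fun w : (ℝ × ℝ) × ℝ => (w.1.1, w.1.2, w.2))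
          exact h4.lintegral_prod_right'
    _ ≤ ∫⁻ σ, jb (-b) σ * ∫⁻ τ, jb (-b) τ * (ENNReal.ofReal (M ^ (-1 + 3 * δ)) *
      ENNReal.ofReal (16 * (300 * (∫⁻ v, jb (-b) v).toReal) ^ (1 - δ) / δ)) := by
        gcongr with σ τ
        exact lintegral_tripleKer_le hb hδ hδ1 hθ hM _ _
    _ = _ := by
        rw [lintegral_mul_const _ (by fun_prop), lintegral_mul_const _ (by fun_prop)]
        ring

theorem lintegral_fin_cons {α : Type*} [MeasureSpace α] [SigmaFinite (volume : Measure α)] {n : ℕ}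
    {f : (Fin (n + 1) → α) → ℝ≥0∞} (hf : Measurable f) :
    ∫⁻ q, f q = ∫⁻ x, ∫⁻ y : Fin n → α, f (Fin.cons x y) := by
  have h := (volume_preserving_piFinSuccAbove (fun _ : Fin (n + 1) => α) 0).symm
  rw [← h.lintegral_comp hf, Measure.volume_eq_prod, lintegral_prod]
  · simp [MeasurableEquiv.piFinSuccAbove, Fin.insertNthEquiv]
  · exact (hf.comp (MeasurableEquiv.measurable _)).aemeasurable

theorem lintegral_fin_snoc {α : Type*} [MeasureSpace α] [SigmaFinite (volume : Measure α)] {n : ℕ}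
    {f : (Fin (n + 1) → α) → ℝ≥0∞} (hf : Measurable f) :
    ∫⁻ q, f q = ∫⁻ y : Fin n → α, ∫⁻ x, f (Fin.snoc y x) := by
  have h := (volume_preserving_piFinSuccAbove (fun _ : Fin (n + 1) => α) (Fin.last n)).symm
  rw [← h.lintegral_comp hf, Measure.volume_eq_prod, lintegral_prod_symm']
  · simp [MeasurableEquiv.piFinSuccAbove, Fin.insertNthEquiv, Fin.insertNth_last']
  · exact hf.comp (MeasurableEquiv.measurable _)

theorem lintegral_fin_four {α : Type*} [MeasureSpace α] [SigmaFinite (volume : Measure α)]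
    {f : (Fin 4 → α) → ℝ≥0∞} (hf : Measurable f) :
    ∫⁻ q, f q = ∫⁻ x, ∫⁻ y, ∫⁻ z, ∫⁻ w, f ![x, y, z, w] := by
  have hc : ∀ (n : ℕ) (x : α), Measurable fun y : Fin n → α =>
      (Fin.cons x y : Fin (n + 1) → α) := by
    intro n x
    refine measurable_pi_iff.2 fun j => ?_
    refine Fin.cases ?_ (fun i => ?_) j
    · simp
    · simpa using measurable_pi_apply i
  refine (lintegral_fin_cons hf).trans ?_
  refine lintegral_congr fun x => ?_
  refine (lintegral_fin_cons (hf.comp (hc _ x))).trans ?_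
  refine lintegral_congr fun y => ?_
  refine (lintegral_fin_cons ((hf.comp (hc _ x)).comp (hc _ y))).trans ?_
  refine lintegral_congr fun z => ?_
  refine (lintegral_fin_cons (((hf.comp (hc _ x)).comp (hc _ y)).comp (hc _ z))).trans ?_
  refine lintegral_congr fun w => ?_
  have h1 : (volume : Measure (Fin 0 → α)) Set.univ = 1 := by
    rw [volume_pi, Measure.pi_univ]
    rfl
  rw [lintegral_unique, h1, mul_one]
  refine congrArg f (funext fun j => ?_)
  fin_cases j <;> rfl

theorem lintegral_mul_le_sqrt_mul_sqrt {α : Type*} [MeasurableSpace α] {μ : Measure α}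
    {f g : α → ℝ≥0∞} (hf : Measurable f) (hg : Measurable g) :
    ∫⁻ a, f a * g a ∂μ ≤ (∫⁻ a, f a ^ 2 ∂μ) ^ (1 / 2 : ℝ) * (∫⁻ a, g a ^ 2 ∂μ) ^ (1 / 2 : ℝ) := by
  have h := ENNReal.lintegral_mul_le_Lp_mul_Lq μ Real.HolderConjugate.two_two
    hf.aemeasurable hg.aemeasurable
  simpa only [ENNReal.rpow_two, Pi.mul_apply] using h

theorem lintegral_fin_three_prod {α : Type*} [MeasureSpace α] [SigmaFinite (volume : Measure α)]
    {f : Fin 3 → α → ℝ≥0∞} (hf : ∀ j, Measurable (f j)) :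
    ∫⁻ q : Fin 3 → α, f 0 (q 0) * f 1 (q 1) * f 2 (q 2) =
      (∫⁻ x, f 0 x) * (∫⁻ x, f 1 x) * ∫⁻ x, f 2 x := by
  have hm : Measurable fun q : Fin 3 → α => f 0 (q 0) * f 1 (q 1) * f 2 (q 2) := by fun_prop
  have h0 : (volume : Measure (Fin 0 → α)) Set.univ = 1 := by
    rw [volume_pi, Measure.pi_univ]
    rfl
  rw [lintegral_fin_cons hm]
  have h2 : ∀ x : α, ∫⁻ y : Fin 2 → α, f 0 x * f 1 (y 0) * f 2 (y 1) =
      f 0 x * ((∫⁻ x, f 1 x) * ∫⁻ x, f 2 x) := by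
    intro x
    rw [lintegral_fin_cons (by fun_prop)]
    have h3 : ∀ y : α, ∫⁻ z : Fin 1 → α, f 0 x * f 1 y * f 2 (z 0) =
        f 0 x * f 1 y * ∫⁻ x, f 2 x := by
      intro y
      rw [lintegral_fin_cons (by fun_prop), ← lintegral_const_mul _ (hf 2)]
      refine lintegral_congr fun w => ?_
      rw [lintegral_unique, h0, mul_one]
      rfl
    refine (lintegral_congr fun y => h3 y).trans ?_
    rw [lintegral_mul_const _ (by fun_prop), lintegral_const_mul _ (by fun_prop), mul_assoc]
  refine (lintegral_congr fun x => h2 x).trans ?_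
  rw [lintegral_mul_const _ (by fun_prop), mul_assoc]

section Canonical

variable {b b' M θ : ℝ} {A B : ℝ≥0∞} {g : ℝ × ℝ → ℝ≥0∞} {F : Fin 4 → ℝ × ℝ → ℝ≥0∞}

theorem lintegral_triple_factor_sq_le
    (hB : ∀ P : ℝ × ℝ, ∫⁻ l : ℝ × ℝ, ∫⁻ i : ℝ × ℝ, tripleKer θ M l.2 i.2 (P - l - i).2 *
        (airyWt (-b) l * airyWt (-b) i * airyWt (-b) (P - l - i)) ≤ B)
    (hg : Measurable g) (hF : ∀ j, Measurable (F j)) :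
    ∫⁻ q : Fin 4 → ℝ × ℝ, (g (∑ j, q j) * F 0 (q 0) * (tripleKer θ M (q 1).2 (q 2).2 (q 3).2 *
      (airyWt (-b / 2) (q 1) * airyWt (-b / 2) (q 2) * airyWt (-b / 2) (q 3)))) ^ 2 ≤
      B * (∫⁻ q, g q ^ 2) * ∫⁻ q, F 0 q ^ 2 := by
  have hm : Measurable fun q : Fin 4 → ℝ × ℝ =>
      (g (∑ j, q j) * F 0 (q 0) * (tripleKer θ M (q 1).2 (q 2).2 (q 3).2 *
      (airyWt (-b / 2) (q 1) * airyWt (-b / 2) (q 2) * airyWt (-b / 2) (q 3)))) ^ 2 := by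
    refine Measurable.pow_const (Measurable.mul (by fun_prop)
      (Measurable.mul (Measurable.tripleKer ?_ ?_ ?_) (by fun_prop))) 2 <;> fun_prop
  set K : ℝ × ℝ → ℝ × ℝ → ℝ × ℝ → ℝ≥0∞ := fun P l i => tripleKer θ M l.2 i.2 (P - l - i).2 *
        (airyWt (-b) l * airyWt (-b) i * airyWt (-b) (P - l - i)) with hK
  have hKm : Measurable fun z : (ℝ × ℝ) × (ℝ × ℝ) × (ℝ × ℝ) => K z.1 z.2.1 z.2.2 := by
    refine Measurable.mul (Measurable.tripleKer ?_ ?_ ?_) ?_ <;> fun_prop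
  have hKm' : ∀ P y, Measurable fun z => K P y z := fun P y =>
    hKm.comp (by fun_prop : Measurable fun z : ℝ × ℝ => (P, y, z))
  have hKm2 : ∀ P, Measurable fun y => ∫⁻ z, K P y z := fun P =>
    Measurable.lintegral_prod_right'
      (hKm.comp (by fun_prop : Measurable fun w : (ℝ × ℝ) × (ℝ × ℝ) => (P, w.1, w.2)))
  rw [lintegral_fin_four hm]
  calc _ = ∫⁻ x, ∫⁻ y, ∫⁻ z, ∫⁻ P, g (x + P) ^ 2 * F 0 x ^ 2 * K P y z := by
        refine lintegral_congr fun x => lintegral_congr fun y => lintegral_congr fun z => ?_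
        rw [← lintegral_sub_right_eq_self _ (y + z)]
        refine lintegral_congr fun P => ?_
        simp only [Fin.sum_univ_four, Matrix.cons_val, hK]
        rw [← sub_sub, show x + y + z + (P - y - z) = x + P by abel]
        rw [mul_pow, mul_pow, mul_pow, mul_pow, mul_pow, tripleKer_sq, airyWt_sq, airyWt_sq,
          airyWt_sq]
    _ = ∫⁻ x, ∫⁻ y, ∫⁻ P, ∫⁻ z, g (x + P) ^ 2 * F 0 x ^ 2 * K P y z := by
        refine lintegral_congr fun x => lintegral_congr fun y => ?_
        rw [lintegral_lintegral_swap]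
        refine Measurable.aemeasurable (Measurable.mul (by fun_prop) ?_)
        exact hKm.comp (by fun_prop : Measurable fun w : (ℝ × ℝ) × (ℝ × ℝ) => (w.2, y, w.1))
    _ = ∫⁻ x, ∫⁻ P, ∫⁻ y, ∫⁻ z, g (x + P) ^ 2 * F 0 x ^ 2 * K P y z := by
        refine lintegral_congr fun x => ?_
        rw [lintegral_lintegral_swap]
        refine Measurable.aemeasurable ?_
        refine Measurable.lintegral_prod_right' (f := fun w : ((ℝ × ℝ) × (ℝ × ℝ)) × (ℝ × ℝ) =>
          g (x + w.1.2) ^ 2 * F 0 x ^ 2 * K w.1.2 w.1.1 w.2) (Measurable.mul (by fun_prop) ?_)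
        exact hKm.comp (by fun_prop :
          Measurable fun w : ((ℝ × ℝ) × (ℝ × ℝ)) × (ℝ × ℝ) => (w.1.2, w.1.1, w.2))
    _ = ∫⁻ x, ∫⁻ P, g (x + P) ^ 2 * F 0 x ^ 2 * ∫⁻ y, ∫⁻ z, K P y z := by
        refine lintegral_congr fun x => lintegral_congr fun P => ?_
        rw [← lintegral_const_mul _ (hKm2 P)]
        refine lintegral_congr fun y => ?_
        rw [← lintegral_const_mul _ (hKm' P y)]
    _ ≤ ∫⁻ x, ∫⁻ P, g (x + P) ^ 2 * F 0 x ^ 2 * B := by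
        gcongr with x P
        exact hB P
    _ = ∫⁻ x, (∫⁻ q, g q ^ 2) * F 0 x ^ 2 * B := by
        refine lintegral_congr fun x => ?_
        rw [lintegral_mul_const _ (by fun_prop), lintegral_mul_const _ (by fun_prop),
          lintegral_add_left_eq_self (fun q => g q ^ 2)]
    _ = _ := by
        rw [lintegral_mul_const _ (by fun_prop), lintegral_const_mul _ (by fun_prop)]
        ring

theorem lintegral_trans_factor_sq_le
    (hA : ∀ P : ℝ × ℝ, ∫⁻ q : ℝ × ℝ, transKer M P.2 q.2 * (airyWt b' (q + P) * airyWt (-b) q) ≤ A)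
    (hF : ∀ j, Measurable (F j)) :
    ∫⁻ q : Fin 4 → ℝ × ℝ, (F 1 (q 1) * F 2 (q 2) * F 3 (q 3) *
      (transKer M (q 1 + q 2 + q 3).2 (q 0).2 *
      (airyWt (b' / 2) (∑ j, q j) * airyWt (-b / 2) (q 0)))) ^ 2 ≤
      A * ((∫⁻ q, F 1 q ^ 2) * (∫⁻ q, F 2 q ^ 2) * ∫⁻ q, F 3 q ^ 2) := by
  have hm : Measurable fun q : Fin 4 → ℝ × ℝ => (F 1 (q 1) * F 2 (q 2) * F 3 (q 3) *
      (transKer M (q 1 + q 2 + q 3).2 (q 0).2 *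
      (airyWt (b' / 2) (∑ j, q j) * airyWt (-b / 2) (q 0)))) ^ 2 := by
    refine Measurable.pow_const (Measurable.mul (by fun_prop)
      (Measurable.mul (Measurable.transKer ?_ ?_) (by fun_prop))) 2 <;> fun_prop
  have hTm : Measurable fun z : (ℝ × ℝ) × (ℝ × ℝ) =>
      transKer M z.2.2 z.1.2 * (airyWt b' (z.1 + z.2) * airyWt (-b) z.1) := by
    refine Measurable.mul (Measurable.transKer ?_ ?_) ?_ <;> fun_prop
  rw [lintegral_fin_cons hm]
  calc _ = ∫⁻ x, ∫⁻ v : Fin 3 → ℝ × ℝ, F 1 (v 0) ^ 2 * F 2 (v 1) ^ 2 * F 3 (v 2) ^ 2 *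
        (transKer M (v 0 + v 1 + v 2).2 x.2 *
          (airyWt b' (x + (v 0 + v 1 + v 2)) * airyWt (-b) x)) := by
        refine lintegral_congr fun x => lintegral_congr fun v => ?_
        have e1 : (Fin.cons x v : Fin 4 → ℝ × ℝ) 1 = v 0 := rfl
        have e2 : (Fin.cons x v : Fin 4 → ℝ × ℝ) 2 = v 1 := rfl
        have e3 : (Fin.cons x v : Fin 4 → ℝ × ℝ) 3 = v 2 := rfl
        rw [Fin.sum_univ_four, Fin.cons_zero, e1, e2, e3]
        rw [mul_pow, mul_pow, mul_pow, mul_pow, mul_pow, transKer_sq, airyWt_sq, airyWt_sq]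
        rw [show x + v 0 + v 1 + v 2 = x + (v 0 + v 1 + v 2) by abel]
    _ = ∫⁻ v : Fin 3 → ℝ × ℝ, ∫⁻ x, F 1 (v 0) ^ 2 * F 2 (v 1) ^ 2 * F 3 (v 2) ^ 2 *
        (transKer M (v 0 + v 1 + v 2).2 x.2 *
          (airyWt b' (x + (v 0 + v 1 + v 2)) * airyWt (-b) x)) := by
        rw [lintegral_lintegral_swap]
        refine Measurable.aemeasurable (Measurable.mul (by fun_prop) ?_)
        exact hTm.comp (by fun_prop : Measurable fun w : (ℝ × ℝ) × (Fin 3 → ℝ × ℝ) =>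
          (w.1, w.2 0 + w.2 1 + w.2 2))
    _ ≤ ∫⁻ v : Fin 3 → ℝ × ℝ, F 1 (v 0) ^ 2 * F 2 (v 1) ^ 2 * F 3 (v 2) ^ 2 * A := by
        refine lintegral_mono fun v => ?_
        simp only
        rw [lintegral_const_mul]
        · gcongr
          exact hA _
        · exact hTm.comp (by fun_prop : Measurable fun x : ℝ × ℝ => (x, v 0 + v 1 + v 2))
    _ = _ := by
        rw [lintegral_mul_const _ (by fun_prop), mul_comm]
        congr 1
        exact lintegral_fin_three_prod (f := fun j q => F j.succ q ^ 2)
          (fun j => (hF _).pow_const 2)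

theorem lintegral_canonical_le
    (hA : ∀ P : ℝ × ℝ, ∫⁻ q : ℝ × ℝ, transKer M P.2 q.2 * (airyWt b' (q + P) * airyWt (-b) q) ≤ A)
    (hB : ∀ P : ℝ × ℝ, ∫⁻ l : ℝ × ℝ, ∫⁻ i : ℝ × ℝ, tripleKer θ M l.2 i.2 (P - l - i).2 *
        (airyWt (-b) l * airyWt (-b) i * airyWt (-b) (P - l - i)) ≤ B)
    (hg : Measurable g) (hF : ∀ j, Measurable (F j)) :
    ∫⁻ q : Fin 4 → ℝ × ℝ, transKer M (q 1 + q 2 + q 3).2 (q 0).2 *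
      tripleKer θ M (q 1).2 (q 2).2 (q 3).2 *
      (g (∑ j, q j) * airyWt (b' / 2) (∑ j, q j) * ∏ j, (F j (q j) * airyWt (-b / 2) (q j))) ≤
      (A * B) ^ (1 / 2 : ℝ) * (∫⁻ q, g q ^ 2) ^ (1 / 2 : ℝ) *
        ∏ j, (∫⁻ q, F j q ^ 2) ^ (1 / 2 : ℝ) := by
  have h2 : (0 : ℝ) ≤ 1 / 2 := by norm_num
  calc _ = ∫⁻ q : Fin 4 → ℝ × ℝ, (g (∑ j, q j) * F 0 (q 0) *
      (tripleKer θ M (q 1).2 (q 2).2 (q 3).2 *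
      (airyWt (-b / 2) (q 1) * airyWt (-b / 2) (q 2) * airyWt (-b / 2) (q 3)))) *
      (F 1 (q 1) * F 2 (q 2) * F 3 (q 3) *
      (transKer M (q 1 + q 2 + q 3).2 (q 0).2 *
      (airyWt (b' / 2) (∑ j, q j) * airyWt (-b / 2) (q 0)))) := by
        refine lintegral_congr fun q => ?_
        rw [Fin.prod_univ_four]
        ring
    _ ≤ _ := lintegral_mul_le_sqrt_mul_sqrt ?_ ?_
    _ ≤ (B * (∫⁻ q, g q ^ 2) * ∫⁻ q, F 0 q ^ 2) ^ (1 / 2 : ℝ) *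
        (A * ((∫⁻ q, F 1 q ^ 2) * (∫⁻ q, F 2 q ^ 2) * ∫⁻ q, F 3 q ^ 2)) ^ (1 / 2 : ℝ) := by
        gcongr
        · exact lintegral_triple_factor_sq_le hB hg hF
        · exact lintegral_trans_factor_sq_le hA hF
    _ = _ := by
        rw [Fin.prod_univ_four]
        simp only [ENNReal.mul_rpow_of_nonneg _ _ h2]
        ring
  · refine Measurable.mul (by fun_prop) (Measurable.mul (Measurable.tripleKer ?_ ?_ ?_) ?_) <;>
      fun_prop
  · refine Measurable.mul (by fun_prop) (Measurable.mul (Measurable.transKer ?_ ?_) ?_) <;>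
      fun_prop

end Canonical

theorem mul_abs_sub_le_abs_sq_sub_sq_of_le_abs_sub {M i j : ℝ} (h : M / 400 ≤ |i - j|) (l : ℝ) :
    M / 400 * |l - 1 * (l + i + j)| ≤ |i ^ 2 - j ^ 2| := by
  have e1 : l - 1 * (l + i + j) = -(i + j) := by ring
  have e2 : i ^ 2 - j ^ 2 = (i - j) * (i + j) := by ring
  rw [e1, e2, abs_neg, abs_mul]
  gcongr

theorem mul_abs_sub_third_le_abs_sq_sub_sq {M l i j : ℝ} (h : M / 400 ≤ |i + j|)
    (hi : |l - i| ≤ |i - j|) (hj : |l - j| ≤ |i - j|) :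
    M / 400 * |l - 1 / 3 * (l + i + j)| ≤ |i ^ 2 - j ^ 2| := by
  have e1 : l - 1 / 3 * (l + i + j) = ((l - i) + (l - j)) / 3 := by ring
  have e2 : i ^ 2 - j ^ 2 = (i + j) * (i - j) := by ring
  have h1 : |l - 1 / 3 * (l + i + j)| ≤ |i - j| := by
    rw [e1, abs_div, abs_of_pos (by norm_num : (0 : ℝ) < 3)]
    have := abs_add_le (l - i) (l - j)
    have := abs_nonneg (i - j)
    linarith
  rw [e2, abs_mul]
  gcongr

theorem le_abs_add_of_abs_sub_lt {M a b c : ℝ} (hab : |a - b| < M / 64) (hac : |a - c| < M / 64)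
    (h : M / 16 ≤ |a| ∨ M / 16 ≤ |b| ∨ M / 16 ≤ |c|) : M / 400 ≤ |a + b| := by
  rw [abs_lt] at hab hac
  simp only [le_abs] at h ⊢
  rcases h with (h | h) | (h | h) | (h | h)
  all_goals first
    | (left; linarith)
    | (right; linarith)

theorem exists_triple_nondegenerate {M : ℝ} {a b c : ℝ} (hM : 0 < M)
    (h : M / 16 ≤ |a| ∨ M / 16 ≤ |b| ∨ M / 16 ≤ |c|) :
    ∃ θ : ℝ, (θ = 1 ∨ θ = 1 / 3) ∧
      (M / 400 * |a - θ * (a + b + c)| ≤ |b ^ 2 - c ^ 2| ∨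
        M / 400 * |b - θ * (b + a + c)| ≤ |a ^ 2 - c ^ 2| ∨
        M / 400 * |c - θ * (c + b + a)| ≤ |b ^ 2 - a ^ 2|) := by
  by_cases h1 : M / 64 ≤ |b - c|
  · exact ⟨1, Or.inl rfl, Or.inl (mul_abs_sub_le_abs_sq_sub_sq_of_le_abs_sub (by linarith) _)⟩
  by_cases h2 : M / 64 ≤ |a - c|
  · exact ⟨1, Or.inl rfl, Or.inr (Or.inl
      (mul_abs_sub_le_abs_sq_sub_sq_of_le_abs_sub (by linarith) _))⟩
  by_cases h3 : M / 64 ≤ |b - a|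
  · exact ⟨1, Or.inl rfl, Or.inr (Or.inr
      (mul_abs_sub_le_abs_sq_sub_sq_of_le_abs_sub (by linarith) _))⟩
  push Not at h1 h2 h3
  have h1' := h1; have h2' := h2; have h3' := h3
  rw [abs_sub_comm] at h1' h2' h3'
  refine ⟨1 / 3, Or.inr rfl, ?_⟩
  rcases le_total |b - c| |a - c| with h4 | h4 <;> rcases le_total |b - c| |b - a| with h5 | h5 <;>
    rcases le_total |a - c| |b - a| with h6 | h6
  all_goals first
    | (left
       refine mul_abs_sub_third_le_abs_sq_sub_sq
         (le_abs_add_of_abs_sub_lt h1 h3 (by tauto)) ?_ ?_ <;>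
         first | assumption | linarith [abs_sub_comm a b] | linarith)
    | (right; left
       refine mul_abs_sub_third_le_abs_sq_sub_sq
         (le_abs_add_of_abs_sub_lt h2 h3' (by tauto)) ?_ ?_ <;>
         linarith [abs_sub_comm a b])
    | (right; right
       refine mul_abs_sub_third_le_abs_sq_sub_sq
         (le_abs_add_of_abs_sub_lt h3 h1 (by tauto)) ?_ ?_ <;>
         linarith [abs_sub_comm a b, abs_sub_comm b c, abs_sub_comm a c])

theorem abs_sub_le_or_abs_add_le_of_abs_sq_sub_sq_lt {r a b : ℝ} (hr : 0 ≤ r)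
    (h : |a ^ 2 - b ^ 2| < r ^ 2) : |a - b| ≤ r ∨ |a + b| ≤ r := by
  by_contra! hc
  have : r ^ 2 < |a ^ 2 - b ^ 2| := by
    rw [show a ^ 2 - b ^ 2 = (a - b) * (a + b) by ring, abs_mul, sq]
    exact mul_lt_mul'' hc.1 hc.2 hr hr
  linarith

theorem exists_transversal {M : ℝ} (hM : 0 < M) {x : Fin 4 → ℝ} (hx : ∃ m, M / 2 ≤ |x m|) :
    ∃ k, M ^ 2 / 400 ≤ |(∑ j, x j) ^ 2 - x k ^ 2| := by
  by_contra! hc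
  have key : ∀ k, |(∑ j, x j) - x k| ≤ M / 20 ∨ |(∑ j, x j) + x k| ≤ M / 20 := fun k =>
    abs_sub_le_or_abs_add_le_of_abs_sq_sub_sq_lt (by positivity)
      ((hc k).trans_eq (by ring))
  obtain ⟨m, hm⟩ := hx
  set S := ∑ j, x j with hS
  rw [Fin.sum_univ_four] at hS
  have hSm : S ≤ -(9 * M / 20) ∨ 9 * M / 20 ≤ S := by
    have := key m
    simp only [abs_le] at this
    rcases le_abs.1 hm with h | h <;> rcases this with ⟨h1, h2⟩ | ⟨h1, h2⟩
    · right; linarith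
    · left; linarith
    · left; linarith
    · right; linarith
  have k0 := key 0
  have k1 := key 1
  have k2 := key 2
  have k3 := key 3
  simp only [abs_le] at k0 k1 k2 k3
  clear_value S
  rcases hSm with h | h <;> rcases k0 with ⟨_, _⟩ | ⟨_, _⟩ <;> rcases k1 with ⟨_, _⟩ | ⟨_, _⟩ <;>
    rcases k2 with ⟨_, _⟩ | ⟨_, _⟩ <;> rcases k3 with ⟨_, _⟩ | ⟨_, _⟩ <;> linarith

theorem exists_transversal_and_large {M : ℝ} (hM : 0 < M) {x : Fin 4 → ℝ}
    (hx : ∃ m, M / 2 ≤ |x m|) :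
    ∃ k, M ^ 2 / 400 ≤ |(∑ j, x j) ^ 2 - x k ^ 2| ∧ ∃ j, j ≠ k ∧ M / 16 ≤ |x j| := by
  obtain ⟨k, hk⟩ := exists_transversal hM hx
  by_cases h : ∃ j, j ≠ k ∧ M / 16 ≤ |x j|
  · exact ⟨k, hk, h⟩
  push Not at h
  obtain ⟨m, hm⟩ := hx
  obtain rfl : m = k := by
    by_contra hne
    have := h m hne
    linarith
  obtain ⟨i, hi⟩ : ∃ i : Fin 4, i ≠ m := exists_ne m
  have hS : 5 * M / 16 ≤ |∑ j, x j| := by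
    rw [← Finset.add_sum_erase _ _ (Finset.mem_univ m)]
    have h1 : |∑ j ∈ Finset.univ.erase m, x j| ≤ 3 * (M / 16) := by
      refine (Finset.abs_sum_le_sum_abs _ _).trans ?_
      refine (Finset.sum_le_card_nsmul _ _ (M / 16) fun j hj => ?_).trans ?_
      · exact (h j (Finset.ne_of_mem_erase hj)).le
      · rw [Finset.card_erase_of_mem (Finset.mem_univ m)]
        simp
    have := abs_sub_abs_le_abs_sub (x m) (-∑ j ∈ Finset.univ.erase m, x j)
    rw [abs_neg, sub_neg_eq_add] at this
    linarith
  refine ⟨i, ?_, m, hi.symm, by linarith⟩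
  refine le_trans ?_ (le_abs_self _)
  have h1 := pow_le_pow_left₀ (by positivity) hS 2
  have h2 := pow_le_pow_left₀ (abs_nonneg _) (h i hi).le 2
  rw [sq_abs] at h1 h2
  nlinarith

theorem exists_perm_fin_four (k : Fin 4) : ∃ π : Equiv.Perm (Fin 4), π 0 = k :=
  ⟨Equiv.swap 0 k, by simp⟩

/-- Any frequency configuration of size comparable to `M` is, up to a permutation, in the region
where both the transversality kernel and the non-degeneracy kernel are one. -/
theorem exists_perm_kernels_eq_one {M : ℝ} (hM : 0 < M) {x : Fin 4 → ℝ} (hxM : ∀ j, |x j| ≤ M)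
    (hx : ∃ m, M / 2 ≤ |x m|) :
    ∃ (π : Equiv.Perm (Fin 4)) (θ : ℝ), (θ = 1 ∨ θ = 1 / 3) ∧
      transKer M (x (π 1) + x (π 2) + x (π 3)) (x (π 0)) = 1 ∧
      tripleKer θ M (x (π 1)) (x (π 2)) (x (π 3)) = 1 := by
  obtain ⟨k, hk, j, hjk, hj⟩ := exists_transversal_and_large hM hx
  obtain ⟨π, rfl⟩ := exists_perm_fin_four k
  have htr : ∀ ρ : Equiv.Perm (Fin 4), ρ 0 = π 0 →
      transKer M (x (ρ 1) + x (ρ 2) + x (ρ 3)) (x (ρ 0)) = 1 := fun ρ hρ => by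
    have hsum : x (ρ 1) + x (ρ 2) + x (ρ 3) + x (ρ 0) = ∑ j, x j := by
      rw [← Equiv.sum_comp ρ x, Fin.sum_univ_four]
      ring
    rw [transKer, hsum, hρ, if_pos ⟨hxM _, hk⟩]
  have hlarge : M / 16 ≤ |x (π 1)| ∨ M / 16 ≤ |x (π 2)| ∨ M / 16 ≤ |x (π 3)| := by
    obtain ⟨i, rfl⟩ := π.surjective j
    fin_cases i
    · exact absurd rfl hjk
    · exact Or.inl hj
    · exact Or.inr (Or.inl hj)
    · exact Or.inr (Or.inr hj)
  obtain ⟨θ, hθ, h | h | h⟩ := exists_triple_nondegenerate hM hlarge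
  · exact ⟨π, θ, hθ, htr π rfl, if_pos ⟨hxM _, hxM _, hxM _, h⟩⟩
  · refine ⟨Equiv.swap 1 2 |>.trans π, θ, hθ, htr _ rfl, if_pos ⟨hxM _, hxM _, hxM _, h⟩⟩
  · refine ⟨Equiv.swap 1 3 |>.trans π, θ, hθ, htr _ rfl, if_pos ⟨hxM _, hxM _, hxM _, h⟩⟩

theorem lintegral_comp_perm {ι α : Type*} [Fintype ι] [MeasureSpace α]
    [SigmaFinite (volume : Measure α)] (π : Equiv.Perm ι) (f : (ι → α) → ℝ≥0∞) :
    ∫⁻ q : ι → α, f (fun j => q (π j)) = ∫⁻ q : ι → α, f q := by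
  have h := (volume_measurePreserving_piCongrLeft (fun _ : ι => α) π.symm)
  rw [← h.lintegral_comp_emb (MeasurableEquiv.measurableEmbedding _) f]
  refine lintegral_congr fun q => ?_
  congr 1
  ext1 j
  have := MeasurableEquiv.piCongrLeft_apply_apply (β := fun _ : ι => α) π.symm q (π j)
  simpa using this.symm

section Shell

variable {b b' M : ℝ} {A B : ℝ≥0∞} {g : ℝ × ℝ → ℝ≥0∞} {F : Fin 4 → ℝ × ℝ → ℝ≥0∞}

theorem lintegral_canonical_perm_le {θ : ℝ}
    (hA : ∀ P : ℝ × ℝ, ∫⁻ q : ℝ × ℝ, transKer M P.2 q.2 * (airyWt b' (q + P) * airyWt (-b) q) ≤ A)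
    (hB : ∀ P : ℝ × ℝ, ∫⁻ l : ℝ × ℝ, ∫⁻ i : ℝ × ℝ, tripleKer θ M l.2 i.2 (P - l - i).2 *
        (airyWt (-b) l * airyWt (-b) i * airyWt (-b) (P - l - i)) ≤ B)
    (hg : Measurable g) (hF : ∀ j, Measurable (F j)) (π : Equiv.Perm (Fin 4)) :
    ∫⁻ q : Fin 4 → ℝ × ℝ, transKer M (q (π 1) + q (π 2) + q (π 3)).2 (q (π 0)).2 *
      tripleKer θ M (q (π 1)).2 (q (π 2)).2 (q (π 3)).2 *
      (g (∑ j, q j) * airyWt (b' / 2) (∑ j, q j) * ∏ j, (F j (q j) * airyWt (-b / 2) (q j))) ≤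
      (A * B) ^ (1 / 2 : ℝ) * (∫⁻ q, g q ^ 2) ^ (1 / 2 : ℝ) *
        ∏ j, (∫⁻ q, F j q ^ 2) ^ (1 / 2 : ℝ) := by
  have h := lintegral_canonical_le hA hB hg (F := fun j => F (π j)) fun j => hF _
  rw [Equiv.prod_comp π fun j => (∫⁻ q, F j q ^ 2) ^ (1 / 2 : ℝ), ← lintegral_comp_perm π] at h
  refine (lintegral_mono fun q => ?_).trans h
  beta_reduce
  rw [Equiv.sum_comp π q, Equiv.prod_comp π fun j => F j (q j) * airyWt (-b / 2) (q j)]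

/-- Indicator of the frequencies of maximal size between `M / 2` and `M`. -/
def shellKer (M : ℝ) (x : Fin 4 → ℝ) : ℝ≥0∞ :=
  open Classical in if (∀ j, |x j| ≤ M) ∧ ∃ m, M / 2 ≤ |x m| then 1 else 0

theorem measurable_shellKer (M : ℝ) : Measurable (shellKer M) := by
  unfold shellKer
  refine Measurable.ite ?_ measurable_const measurable_const
  have h1 : MeasurableSet {x : Fin 4 → ℝ | ∀ j, |x j| ≤ M} := by
    simp only [Set.ofPred_forall]
    exact MeasurableSet.iInter fun j => measurableSet_le (by fun_prop) (by fun_prop)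
  have h2 : MeasurableSet {x : Fin 4 → ℝ | ∃ j, M / 2 ≤ |x j|} := by
    simp only [Set.ofPred_exists]
    exact MeasurableSet.iUnion fun j => measurableSet_le (by fun_prop) (by fun_prop)
  exact h1.inter h2

theorem shellKer_le (hM : 0 < M) (x : Fin 4 → ℝ) :
    shellKer M x ≤ ∑ p : Equiv.Perm (Fin 4) × Bool,
      transKer M (x (p.1 1) + x (p.1 2) + x (p.1 3)) (x (p.1 0)) *
        tripleKer (if p.2 then 1 else 1 / 3) M (x (p.1 1)) (x (p.1 2)) (x (p.1 3)) := by
  unfold shellKer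
  split_ifs with h
  · obtain ⟨π, θ, hθ, h1, h2⟩ := exists_perm_kernels_eq_one hM h.1 h.2
    obtain ⟨c, hc⟩ : ∃ c : Bool, θ = if c then 1 else 1 / 3 := by
      rcases hθ with rfl | rfl
      · exact ⟨true, by simp⟩
      · exact ⟨false, by simp⟩
    refine le_trans ?_ (Finset.single_le_sum (fun _ _ => zero_le) (Finset.mem_univ (π, c)))
    rw [hc] at h2
    rw [h1, h2, one_mul]
  · exact zero_le

theorem lintegral_shell_le (hM : 0 < M)
    (hA : ∀ P : ℝ × ℝ, ∫⁻ q : ℝ × ℝ, transKer M P.2 q.2 * (airyWt b' (q + P) * airyWt (-b) q) ≤ A)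
    (hB : ∀ θ : ℝ, |θ| ≤ 1 → ∀ P : ℝ × ℝ, ∫⁻ l : ℝ × ℝ, ∫⁻ i : ℝ × ℝ,
      tripleKer θ M l.2 i.2 (P - l - i).2 *
        (airyWt (-b) l * airyWt (-b) i * airyWt (-b) (P - l - i)) ≤ B)
    (hg : Measurable g) (hF : ∀ j, Measurable (F j)) :
    ∫⁻ q : Fin 4 → ℝ × ℝ, shellKer M (fun j => (q j).2) *
      (g (∑ j, q j) * airyWt (b' / 2) (∑ j, q j) * ∏ j, (F j (q j) * airyWt (-b / 2) (q j))) ≤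
      48 * ((A * B) ^ (1 / 2 : ℝ) * (∫⁻ q, g q ^ 2) ^ (1 / 2 : ℝ) *
        ∏ j, (∫⁻ q, F j q ^ 2) ^ (1 / 2 : ℝ)) := by
  have hθ : ∀ c : Bool, |if c then 1 else 1 / 3| ≤ (1 : ℝ) := by
    intro c; cases c <;> norm_num
  calc _ ≤ ∫⁻ q : Fin 4 → ℝ × ℝ, ∑ p : Equiv.Perm (Fin 4) × Bool,
        transKer M (q (p.1 1) + q (p.1 2) + q (p.1 3)).2 (q (p.1 0)).2 *
        tripleKer (if p.2 then 1 else 1 / 3) M (q (p.1 1)).2 (q (p.1 2)).2 (q (p.1 3)).2 *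
        (g (∑ j, q j) * airyWt (b' / 2) (∑ j, q j) *
          ∏ j, (F j (q j) * airyWt (-b / 2) (q j))) := by
        refine lintegral_mono fun q => ?_
        rw [← Finset.sum_mul]
        gcongr
        exact shellKer_le hM _
    _ ≤ ∑ p : Equiv.Perm (Fin 4) × Bool, ((A * B) ^ (1 / 2 : ℝ) * (∫⁻ q, g q ^ 2) ^ (1 / 2 : ℝ) *
        ∏ j, (∫⁻ q, F j q ^ 2) ^ (1 / 2 : ℝ)) := by
        rw [lintegral_finsetSum]
        · exact Finset.sum_le_sum fun p _ =>
            lintegral_canonical_perm_le hA (hB _ (hθ p.2)) hg hF p.1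
        · intro p _
          refine (Measurable.mul (Measurable.transKer ?_ ?_)
            (Measurable.tripleKer ?_ ?_ ?_)).mul ?_ <;> fun_prop
    _ = _ := by
        have hcard : Finset.card (Finset.univ : Finset (Equiv.Perm (Fin 4) × Bool)) = 48 := by
          rw [Finset.card_univ, Fintype.card_prod, Fintype.card_perm, Fintype.card_fin,
            Fintype.card_bool]
          norm_num [Nat.factorial]
        rw [Finset.sum_const, hcard, nsmul_eq_mul, Nat.cast_ofNat]

end Shell

theorem mI_pos {s N : ℝ} (hN : 0 < N) (x : ℝ) : 0 < mI s N x := by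
  unfold mI
  split_ifs with h
  · exact one_pos
  · have : 0 < |x| := hN.trans (not_le.1 h)
    positivity

theorem mI_inv_le {s N M x : ℝ} (hs : s ≤ 0) (hN : 0 < N) (hNM : N ≤ M) (hx : |x| ≤ M) :
    (mI s N x)⁻¹ ≤ (M / N) ^ (-s) := by
  unfold mI
  split_ifs with h
  · rw [inv_one]
    exact Real.one_le_rpow ((one_le_div hN).2 hNM) (by linarith)
  · rw [← Real.rpow_neg (by positivity)]
    exact Real.rpow_le_rpow (by positivity) (by gcongr) (by linarith)

theorem abs_mul_mI_le {s N M x : ℝ} (hs : s ≤ 0) (hs1 : -1 ≤ s) (hN : 0 < N) (hNM : N ≤ M)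
    (hx : |x| ≤ 4 * M) : |x| * mI s N x ≤ 4 * M * (M / N) ^ s := by
  have hM : 0 < M := hN.trans_le hNM
  have hr : 1 ≤ M / N := (one_le_div hN).2 hNM
  have e : ∀ y : ℝ, 0 < y → y * (y / N) ^ s = N * (y / N) ^ (1 + s) := fun y hy => by
    rw [Real.rpow_add (by positivity), Real.rpow_one]
    field_simp
  rw [mul_assoc, e M hM]
  have h1 : 1 ≤ (M / N) ^ (1 + s) := Real.one_le_rpow hr (by linarith)
  unfold mI
  split_ifs with h
  · nlinarith
  · have hx0 : 0 < |x| := hN.trans (not_le.1 h)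
    rw [e _ hx0]
    calc N * (|x| / N) ^ (1 + s) ≤ N * (4 * (M / N)) ^ (1 + s) := by
          gcongr
          · linarith
          · rw [← mul_div_assoc]; gcongr
      _ = 4 ^ (1 + s) * (N * (M / N) ^ (1 + s)) := by
          rw [Real.mul_rpow (by norm_num) (by positivity)]; ring
      _ ≤ 4 * (N * (M / N) ^ (1 + s)) := by
          gcongr
          calc (4 : ℝ) ^ (1 + s) ≤ 4 ^ (1 : ℝ) :=
                Real.rpow_le_rpow_of_exponent_le (by norm_num) (by linarith)
            _ = 4 := Real.rpow_one _

/-- The symbol `ξ m(ξ) / ∏ m(ξ_j)`, restricted to `max |ξ_j| > N`. -/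
def highSymbol (s N : ℝ) (ξ : Fin 4 → ℝ) : ℂ :=
  if N < max (max (max |ξ 0| |ξ 1|) |ξ 2|) |ξ 3| then
    (((ξ 0 + ξ 1 + ξ 2 + ξ 3) * mI s N (ξ 0 + ξ 1 + ξ 2 + ξ 3) /
      (mI s N (ξ 0) * mI s N (ξ 1) * mI s N (ξ 2) * mI s N (ξ 3)) : ℝ) : ℂ)
  else 0

theorem abs_symbol_le {s N M : ℝ} (hs : s ≤ 0) (hs1 : -1 ≤ s) (hN : 0 < N) (hNM : N ≤ M)
    {ξ : Fin 4 → ℝ} (hξ : ∀ j, |ξ j| ≤ M) :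
    |(ξ 0 + ξ 1 + ξ 2 + ξ 3) * mI s N (ξ 0 + ξ 1 + ξ 2 + ξ 3) /
      (mI s N (ξ 0) * mI s N (ξ 1) * mI s N (ξ 2) * mI s N (ξ 3))| ≤
      4 * M * (M / N) ^ (-3 * s) := by
  have hM : 0 < M := hN.trans_le hNM
  have hsum : |ξ 0 + ξ 1 + ξ 2 + ξ 3| ≤ 4 * M := by
    have h0 := hξ 0; have h1 := hξ 1; have h2 := hξ 2; have h3 := hξ 3
    rw [abs_le] at *
    constructor <;> linarith
  have hm := fun x => mI_pos (s := s) hN x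
  have hi := fun j => mI_inv_le hs hN hNM (hξ j)
  have hip := fun j => inv_nonneg.2 (hm (ξ j)).le
  rw [div_eq_mul_inv, mul_inv, mul_inv, mul_inv, abs_mul, abs_mul, abs_of_pos (hm _),
    abs_of_nonneg (mul_nonneg (mul_nonneg (mul_nonneg (hip 0) (hip 1)) (hip 2)) (hip 3))]
  calc _ ≤ (4 * M * (M / N) ^ s) * ((M / N) ^ (-s) * (M / N) ^ (-s) * (M / N) ^ (-s) *
        (M / N) ^ (-s)) := by
        have h0 := hi 0; have h1 := hi 1; have h2 := hi 2; have h3 := hi 3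
        have p0 := hip 0; have p1 := hip 1; have p2 := hip 2; have p3 := hip 3
        have := abs_mul_mI_le hs hs1 hN hNM hsum
        gcongr
    _ = _ := by
        have hr : 0 < M / N := by positivity
        rw [mul_assoc, ← Real.rpow_add hr, ← Real.rpow_add hr, ← Real.rpow_add hr,
          ← Real.rpow_add hr]
        ring_nf

theorem enorm_highSymbol_le {s N : ℝ} (hs : s ≤ 0) (hs1 : -1 ≤ s) (hN : 0 < N) (ξ : Fin 4 → ℝ) :
    ‖highSymbol s N ξ‖ₑ ≤ ∑' n : ℕ,
      ENNReal.ofReal (4 * (2 ^ (n + 1) * N) * (2 ^ (n + 1)) ^ (-3 * s)) *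
        shellKer (2 ^ (n + 1) * N) ξ := by
  unfold highSymbol
  split_ifs with h
  swap
  · simp
  set m := max (max (max |ξ 0| |ξ 1|) |ξ 2|) |ξ 3| with hm
  obtain ⟨n, hn1, hn2⟩ := exists_nat_pow_near ((one_le_div hN).2 h.le) one_lt_two
  rw [le_div_iff₀ hN] at hn1
  rw [div_lt_iff₀ hN] at hn2
  have hle : ∀ j, |ξ j| ≤ m := by
    intro j; rw [hm]; fin_cases j <;> simp
  have hex : ∃ j, |ξ j| = m := by
    rw [hm]
    rcases max_choice (max (max |ξ 0| |ξ 1|) |ξ 2|) |ξ 3| with h1 | h1 <;> rw [h1]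
    · rcases max_choice (max |ξ 0| |ξ 1|) |ξ 2| with h2 | h2 <;> rw [h2]
      · rcases max_choice |ξ 0| |ξ 1| with h3 | h3 <;> rw [h3]
        · exact ⟨0, rfl⟩
        · exact ⟨1, rfl⟩
      · exact ⟨2, rfl⟩
    · exact ⟨3, rfl⟩
  refine le_trans ?_ (ENNReal.le_tsum n)
  have hξ : ∀ j, |ξ j| ≤ 2 ^ (n + 1) * N := fun j => (hle j).trans hn2.le
  have hlow : ∃ j, 2 ^ (n + 1) * N / 2 ≤ |ξ j| := by
    obtain ⟨j, hj⟩ := hex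
    refine ⟨j, ?_⟩
    rw [hj, pow_succ]
    linarith
  rw [shellKer, if_pos ⟨hξ, hlow⟩, mul_one, ← ofReal_norm, Complex.norm_real, Real.norm_eq_abs]
  have := abs_symbol_le hs hs1 hN (le_mul_of_one_le_left hN.le
    (one_le_pow₀ one_le_two : (1 : ℝ) ≤ 2 ^ (n + 1))) hξ
  rw [mul_div_cancel_right₀ _ hN.ne'] at this
  exact ENNReal.ofReal_le_ofReal this

theorem dyadic_factor_le {s δ ε N : ℝ} (hN : 1 ≤ N) (hδε : 22 * δ ≤ ε) (hδ : 0 ≤ δ)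
    (hδs : 22 * δ ≤ 1 / 2 + 3 * s) (n : ℕ) :
    4 * (2 ^ (n + 1) * N) * (2 ^ (n + 1)) ^ (-3 * s) *
      (2 ^ (n + 1) * N) ^ (-(3 / 2) + 21 / 2 * δ) ≤
      4 * N ^ (-(1 : ℝ) / 2 + ε) * (2 ^ (-((1 / 2 + 3 * s) / 2))) ^ (n + 1) := by
  have hN0 : 0 < N := by linarith
  have ht : (1 : ℝ) ≤ 2 ^ (n + 1) := one_le_pow₀ one_le_two
  set t : ℝ := 2 ^ (n + 1) with htd
  have ht0 : 0 < t := by linarith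
  have e2 : ((2 : ℝ) ^ (-((1 / 2 + 3 * s) / 2))) ^ (n + 1) = t ^ (-((1 / 2 + 3 * s) / 2)) := by
    rw [htd, ← Real.rpow_natCast, ← Real.rpow_natCast, ← Real.rpow_mul (by norm_num),
      ← Real.rpow_mul (by norm_num), mul_comm]
  rw [e2]
  calc _ = 4 * (N ^ (1 : ℝ) * N ^ (-(3 / 2) + 21 / 2 * δ)) *
        (t ^ (1 : ℝ) * t ^ (-3 * s) * t ^ (-(3 / 2) + 21 / 2 * δ)) := by
        rw [Real.mul_rpow ht0.le hN0.le, Real.rpow_one, Real.rpow_one]; ring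
    _ = 4 * N ^ (1 + (-(3 / 2) + 21 / 2 * δ)) * t ^ (1 + -3 * s + (-(3 / 2) + 21 / 2 * δ)) := by
        rw [← Real.rpow_add hN0, ← Real.rpow_add ht0, ← Real.rpow_add ht0]
    _ ≤ _ := by
        refine mul_le_mul (mul_le_mul_of_nonneg_left
          (Real.rpow_le_rpow_of_exponent_le hN (by linarith)) (by norm_num))
          (Real.rpow_le_rpow_of_exponent_le ht (by linarith)) (by positivity) (by positivity)

/-- Dual form of the quadrilinear estimate. -/
theorem exists_dual_quadrilinear_bound {s ε : ℝ} (hs : -1 / 6 < s) (hs0 : s < 0) (hε : 0 < ε) :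
    ∃ b b' : ℝ, 1 / 2 < b ∧ b < 1 ∧ b - 1 < b' ∧ b' < 0 ∧ ∃ C : ℝ≥0∞, C ≠ ∞ ∧
      ∀ N : ℝ, 1 ≤ N → ∀ (g : ℝ × ℝ → ℝ≥0∞) (F : Fin 4 → ℝ × ℝ → ℝ≥0∞), Measurable g →
        (∀ j, Measurable (F j)) →
        ∫⁻ q : Fin 4 → ℝ × ℝ, ‖highSymbol s N fun j => (q j).2‖ₑ *
          (g (∑ j, q j) * airyWt (b' / 2) (∑ j, q j) *
            ∏ j, (F j (q j) * airyWt (-b / 2) (q j))) ≤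
          C * ENNReal.ofReal (N ^ (-(1 : ℝ) / 2 + ε)) * (∫⁻ q, g q ^ 2) ^ (1 / 2 : ℝ) *
            ∏ j, (∫⁻ q, F j q ^ 2) ^ (1 / 2 : ℝ) := by
  set δ := min ε (1 / 2 + 3 * s) / 22 with hδd
  have hη : 0 < 1 / 2 + 3 * s := by linarith
  have hδ : 0 < δ := by positivity
  have hδε : 22 * δ ≤ ε := by
    have := min_le_left ε (1 / 2 + 3 * s); linarith
  have hδs : 22 * δ ≤ 1 / 2 + 3 * s := by
    have := min_le_right ε (1 / 2 + 3 * s); linarith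
  clear_value δ
  have hb : 1 / 2 < 1 / 2 + δ := by linarith
  obtain ⟨C₁, hC₁, hA⟩ := exists_trans_sup_le (b := 1 / 2 + δ) (b' := -(1 / 2) + 2 * δ) hb
    (by linarith) (by linarith)
  obtain ⟨C₂, hC₂, hB⟩ := exists_triple_sup_le (b := 1 / 2 + δ) hb hδ (by linarith)
  set r : ℝ := 2 ^ (-((1 / 2 + 3 * s) / 2)) with hr
  have hr1 : r < 1 := Real.rpow_lt_one_of_one_lt_of_neg one_lt_two (by linarith)
  have hr0 : 0 < r := by positivity
  refine ⟨1 / 2 + δ, -(1 / 2) + 2 * δ, hb, by linarith, by linarith, by linarith,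
    48 * (C₁ * C₂) ^ (1 / 2 : ℝ) * (4 * ∑' n : ℕ, ENNReal.ofReal r ^ (n + 1)), ?_, ?_⟩
  · refine ENNReal.mul_ne_top (ENNReal.mul_ne_top (by norm_num)
      (ENNReal.rpow_ne_top_of_nonneg (by norm_num) (ENNReal.mul_ne_top hC₁ hC₂)))
      (ENNReal.mul_ne_top (by norm_num) ?_)
    simp only [pow_succ, ENNReal.tsum_mul_right, ENNReal.tsum_geometric]
    refine ENNReal.mul_ne_top (ENNReal.inv_ne_top.2 ?_) ENNReal.ofReal_ne_top
    rw [Ne, tsub_eq_zero_iff_le, not_le]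
    exact ENNReal.ofReal_lt_one.2 hr1
  intro N hN g F hg hF
  have hN0 : 0 < N := by linarith
  set X := (∫⁻ q, g q ^ 2) ^ (1 / 2 : ℝ) * ∏ j, (∫⁻ q, F j q ^ 2) ^ (1 / 2 : ℝ) with hX
  have hMn : ∀ n : ℕ, 1 ≤ 2 ^ (n + 1) * N := fun n =>
    one_le_mul_of_one_le_of_one_le (one_le_pow₀ one_le_two) hN
  have hsh : ∀ n : ℕ, ∫⁻ q : Fin 4 → ℝ × ℝ, shellKer (2 ^ (n + 1) * N) (fun j => (q j).2) *
      (g (∑ j, q j) * airyWt ((-(1 / 2) + 2 * δ) / 2) (∑ j, q j) *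
        ∏ j, (F j (q j) * airyWt (-(1 / 2 + δ) / 2) (q j))) ≤
      48 * (ENNReal.ofReal ((2 ^ (n + 1) * N) ^ (-(3 / 2) + 21 / 2 * δ)) *
        (C₁ * C₂) ^ (1 / 2 : ℝ) * X) := fun n => by
    have hM0 : 0 < 2 ^ (n + 1) * N := by positivity
    refine (lintegral_shell_le hM0 (hA _ (hMn n)) (fun θ hθ => hB _ θ (hMn n) hθ) hg hF).trans_eq ?_
    rw [mul_mul_mul_comm (ENNReal.ofReal _) C₁, ← ENNReal.ofReal_mul (by positivity),
      ← Real.rpow_add hM0, ENNReal.mul_rpow_of_nonneg _ _ (by norm_num : (0 : ℝ) ≤ 1 / 2),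
      ENNReal.ofReal_rpow_of_nonneg (by positivity) (by norm_num), ← Real.rpow_mul hM0.le,
      hX, ← mul_assoc (ENNReal.ofReal _ * _)]
    ring_nf
  calc _ ≤ ∫⁻ q : Fin 4 → ℝ × ℝ, ∑' n : ℕ,
        ENNReal.ofReal (4 * (2 ^ (n + 1) * N) * (2 ^ (n + 1)) ^ (-3 * s)) *
        (shellKer (2 ^ (n + 1) * N) (fun j => (q j).2) *
        (g (∑ j, q j) * airyWt ((-(1 / 2) + 2 * δ) / 2) (∑ j, q j) *
        ∏ j, (F j (q j) * airyWt (-(1 / 2 + δ) / 2) (q j)))) := by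
        refine lintegral_mono fun q => ?_
        simp_rw [← mul_assoc (ENNReal.ofReal _) (shellKer _ _)]
        rw [ENNReal.tsum_mul_right]
        gcongr
        exact enorm_highSymbol_le hs0.le (by linarith) hN0 _
    _ = ∑' n : ℕ, ENNReal.ofReal (4 * (2 ^ (n + 1) * N) * (2 ^ (n + 1)) ^ (-3 * s)) *
        ∫⁻ q : Fin 4 → ℝ × ℝ, (shellKer (2 ^ (n + 1) * N) (fun j => (q j).2) *
        (g (∑ j, q j) * airyWt ((-(1 / 2) + 2 * δ) / 2) (∑ j, q j) *
        ∏ j, (F j (q j) * airyWt (-(1 / 2 + δ) / 2) (q j)))) := by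
        have hm : ∀ n : ℕ, Measurable fun q : Fin 4 → ℝ × ℝ =>
            shellKer (2 ^ (n + 1) * N) (fun j => (q j).2) *
            (g (∑ j, q j) * airyWt ((-(1 / 2) + 2 * δ) / 2) (∑ j, q j) *
            ∏ j, (F j (q j) * airyWt (-(1 / 2 + δ) / 2) (q j))) := fun n =>
          ((measurable_shellKer _).comp (by fun_prop)).mul (by fun_prop)
        rw [lintegral_tsum fun n => ((hm n).const_mul _).aemeasurable]
        exact tsum_congr fun n => lintegral_const_mul _ (hm n)
    _ ≤ ∑' n : ℕ, (48 * (C₁ * C₂) ^ (1 / 2 : ℝ) * 4 * ENNReal.ofReal (N ^ (-(1 : ℝ) / 2 + ε)) * X) *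
        ENNReal.ofReal r ^ (n + 1) := by
        refine ENNReal.tsum_le_tsum fun n => ?_
        calc _ ≤ _ := mul_le_mul_right (hsh n) _
          _ = 48 * (C₁ * C₂) ^ (1 / 2 : ℝ) * X *
              ENNReal.ofReal (4 * (2 ^ (n + 1) * N) * (2 ^ (n + 1)) ^ (-3 * s) *
              (2 ^ (n + 1) * N) ^ (-(3 / 2) + 21 / 2 * δ)) := by
              rw [ENNReal.ofReal_mul
                (p := 4 * (2 ^ (n + 1) * N) * (2 ^ (n + 1)) ^ (-3 * s)) (by positivity)]
              ring
          _ ≤ 48 * (C₁ * C₂) ^ (1 / 2 : ℝ) * X *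
              ENNReal.ofReal (4 * N ^ (-(1 : ℝ) / 2 + ε) * r ^ (n + 1)) := by
              exact mul_le_mul_right
                (ENNReal.ofReal_le_ofReal (dyadic_factor_le hN hδε hδ.le hδs n)) _
          _ = _ := by
              rw [ENNReal.ofReal_mul (by positivity), ENNReal.ofReal_mul (by positivity),
                ENNReal.ofReal_pow hr0.le, ENNReal.ofReal_ofNat]
              ring
    _ = _ := by
        rw [ENNReal.tsum_mul_left, hX]
        ring

theorem lintegral_sq_le_of_forall_lintegral_mul_le {α : Type*} [MeasurableSpace α] {μ : Measure α}
    [SigmaFinite μ] {T : α → ℝ≥0∞} {A : ℝ≥0∞}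
    (hA : ∀ g : α → ℝ≥0∞, Measurable g →
      ∫⁻ x, T x * g x ∂μ ≤ A * (∫⁻ x, g x ^ 2 ∂μ) ^ (1 / 2 : ℝ)) :
    ∫⁻ x, T x ^ 2 ∂μ ≤ A ^ 2 := by
  have key : ∀ g : α → ℝ≥0∞, Measurable g → (∀ x, g x ≤ T x) → ∫⁻ x, g x ^ 2 ∂μ < ∞ →
      ∫⁻ x, g x ^ 2 ∂μ ≤ A ^ 2 := fun g hg hgT hfin => by
    set I := ∫⁻ x, g x ^ 2 ∂μ with hI
    have h1 : I ≤ A * I ^ (1 / 2 : ℝ) := by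
      refine le_trans (lintegral_mono fun x => ?_) (hA g hg)
      rw [sq]
      gcongr
      exact hgT x
    rcases eq_or_ne I 0 with h0 | h0
    · rw [h0]; exact zero_le
    have hsq : I = I ^ (1 / 2 : ℝ) * I ^ (1 / 2 : ℝ) := by
      rw [← ENNReal.rpow_add _ _ h0 hfin.ne]; norm_num
    have hne : I ^ (1 / 2 : ℝ) ≠ 0 := by
      intro h; rw [h, mul_zero] at hsq; exact h0 hsq
    have hnt : I ^ (1 / 2 : ℝ) ≠ ∞ := ENNReal.rpow_ne_top_of_nonneg (by norm_num) hfin.ne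
    have h2 : I ^ (1 / 2 : ℝ) ≤ A := by
      rw [← ENNReal.mul_le_mul_iff_left hne hnt, ← hsq]
      exact h1
    rw [hsq, sq]
    gcongr
  rw [lintegral_eq_nnreal]
  refine iSup₂_le fun φ hφ => le_of_forall_lt fun L hL => ?_
  rw [← SimpleFunc.lintegral_eq_lintegral, SimpleFunc.coe_map] at hL
  obtain ⟨g, hg, hfin, hLg⟩ := exists_lt_lintegral_simpleFunc_of_lt_lintegral (f := φ) hL
  have hsq : ∀ x, ((g x : ℝ≥0∞) ^ (1 / 2 : ℝ)) ^ 2 = g x := fun x => by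
    rw [← ENNReal.rpow_natCast, ← ENNReal.rpow_mul]; norm_num
  have := key (fun x => (g x : ℝ≥0∞) ^ (1 / 2 : ℝ))
    (g.measurable.coe_nnreal_ennreal.pow_const _) (fun x => ?_) (by simpa only [hsq] using hfin)
  · simp only [hsq] at this
    exact hLg.trans_le this
  · have h1 : (g x : ℝ≥0∞) ≤ T x ^ 2 := (ENNReal.coe_le_coe.2 (hg x)).trans (hφ x)
    calc (g x : ℝ≥0∞) ^ (1 / 2 : ℝ) ≤ (T x ^ 2) ^ (1 / 2 : ℝ) := by gcongr
      _ = T x := by rw [← ENNReal.rpow_natCast, ← ENNReal.rpow_mul]; norm_num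

/-- The spacetime Fourier transform of a Schwartz function, as a Schwartz function. -/
theorem exists_schwartz_eq_FT2 (v : SchwartzMap (ℝ × ℝ) ℂ) :
    ∃ S : SchwartzMap (ℝ × ℝ) ℂ, ∀ q : ℝ × ℝ, S q = FT2 v q.1 q.2 := by
  set e : WithLp 2 (ℝ × ℝ) ≃L[ℝ] (ℝ × ℝ) := WithLp.prodContinuousLinearEquiv 2 ℝ ℝ ℝ with he
  set w : SchwartzMap (WithLp 2 (ℝ × ℝ)) ℂ :=
    SchwartzMap.compCLMOfContinuousLinearEquiv ℂ e v with hw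
  have hπ : (2 * Real.pi)⁻¹ ≠ 0 := by positivity
  set f : (ℝ × ℝ) ≃L[ℝ] WithLp 2 (ℝ × ℝ) :=
    (ContinuousLinearEquiv.smulLeft (Units.mk0 _ hπ)).trans e.symm with hf
  refine ⟨SchwartzMap.compCLMOfContinuousLinearEquiv ℂ f (FourierTransform.fourier w), fun q => ?_⟩
  rw [SchwartzMap.compCLMOfContinuousLinearEquiv_apply, Function.comp_apply,
    SchwartzMap.fourier_coe, Real.fourier_eq', FT2,
    ← (WithLp.volume_preserving_toLp ℝ ℝ).integral_comp
      (MeasurableEquiv.toLp 2 (ℝ × ℝ)).measurableEmbedding]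
  refine integral_congr_ae (Filter.Eventually.of_forall fun p => ?_)
  have h1 : w (WithLp.toLp 2 p) = v p := rfl
  have h2 : f q = WithLp.toLp 2 ((2 * Real.pi)⁻¹ • q) := rfl
  simp only [h1, h2, WithLp.prod_inner_apply, smul_eq_mul]
  congr 2
  have hπ' : (Real.pi : ℂ) ≠ 0 := by exact_mod_cast Real.pi_ne_zero
  simp
  field_simp

theorem integrable_wgt_mul_norm_sq {b : ℝ} (hb1 : b ≤ 1)
    (S : SchwartzMap (ℝ × ℝ) ℂ) :
    Integrable fun q : ℝ × ℝ => wgt 0 b q.1 q.2 * ‖S q‖ ^ 2 := by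
  set c := SchwartzMap.seminorm ℝ 0 0 S
  have hInt : Integrable fun q : ℝ × ℝ =>
      c * (‖q‖ ^ 0 * ‖S q‖ + 2 * (‖q‖ ^ 2 * ‖S q‖) + 2 * (‖q‖ ^ 6 * ‖S q‖)) :=
    (((S.integrable_pow_mul volume 0).add ((S.integrable_pow_mul volume 2).const_mul 2)).add
      ((S.integrable_pow_mul volume 6).const_mul 2)).const_mul c
  refine hInt.mono' ?_ (Filter.Eventually.of_forall fun q => ?_)
  · refine AEStronglyMeasurable.mul ?_ (by fun_prop)
    unfold wgt
    fun_prop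
  · have h1 : (1 : ℝ) ≤ 1 + (q.1 - q.2 ^ 3) ^ 2 := by nlinarith [sq_nonneg (q.1 - q.2 ^ 3)]
    have hq1 : q.1 ^ 2 ≤ ‖q‖ ^ 2 := by
      rw [← sq_abs]; gcongr; exact norm_fst_le q
    have hq2 : q.2 ^ 6 ≤ ‖q‖ ^ 6 := by
      rw [← Even.pow_abs (by decide : Even 6)]; gcongr; exact norm_snd_le q
    have hw : wgt 0 b q.1 q.2 ≤ 1 + 2 * ‖q‖ ^ 2 + 2 * ‖q‖ ^ 6 := by
      rw [wgt, Real.rpow_zero, one_mul]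
      refine (Real.rpow_le_rpow_of_exponent_le h1 hb1).trans ?_
      rw [Real.rpow_one]
      nlinarith [sq_nonneg (q.1 + q.2 ^ 3)]
    have hw0 : 0 ≤ wgt 0 b q.1 q.2 := by unfold wgt; positivity
    have hc : ‖S q‖ ≤ c := S.norm_le_seminorm ℝ q
    rw [Real.norm_of_nonneg (by positivity)]
    calc _ ≤ (1 + 2 * ‖q‖ ^ 2 + 2 * ‖q‖ ^ 6) * (c * ‖S q‖) := by
          rw [sq]; gcongr
      _ = _ := by ring

theorem ofReal_wgt_zero (β : ℝ) (q : ℝ × ℝ) : ENNReal.ofReal (wgt 0 β q.1 q.2) = airyWt β q := by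
  rw [wgt, Real.rpow_zero, one_mul, airyWt, jb]

theorem measurable_mI (s N : ℝ) : Measurable (mI s N) := by
  unfold mI
  exact Measurable.ite (measurableSet_le (by fun_prop) (by fun_prop)) measurable_const (by fun_prop)

theorem measurable_highSymbol (s N : ℝ) : Measurable (highSymbol s N) := by
  unfold highSymbol
  have hm : ∀ {f : (Fin 4 → ℝ) → ℝ}, Measurable f → Measurable fun ξ => mI s N (f ξ) :=
    fun hf => (measurable_mI s N).comp hf
  refine Measurable.ite (measurableSet_lt (by fun_prop) (by fun_prop)) ?_ measurable_const
  refine Complex.measurable_ofReal.comp (Measurable.div (Measurable.mul (by fun_prop)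
    (hm (by fun_prop))) (Measurable.mul (Measurable.mul (Measurable.mul ?_ ?_) ?_) ?_)) <;>
    exact hm (by fun_prop)

theorem lintegral_airyWt_mul_sq_eq_Xnorm {b : ℝ} (hb1 : b ≤ 1) (v : SchwartzMap (ℝ × ℝ) ℂ) :
    (∫⁻ q : ℝ × ℝ, (‖FT2 v q.1 q.2‖ₑ * airyWt (b / 2) q) ^ 2) ^ (1 / 2 : ℝ) =
      ENNReal.ofReal (Xnorm 0 b v) := by
  obtain ⟨S, hS⟩ := exists_schwartz_eq_FT2 v
  have hInt := integrable_wgt_mul_norm_sq hb1 S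
  simp only [hS] at hInt
  have hw : ∀ q : ℝ × ℝ, 0 ≤ wgt 0 b q.1 q.2 := fun q => by unfold wgt; positivity
  have h0 : 0 ≤ ∫ q : ℝ × ℝ, wgt 0 b q.1 q.2 * ‖FT2 v q.1 q.2‖ ^ 2 :=
    integral_nonneg fun q => mul_nonneg (hw q) (by positivity)
  rw [Xnorm, Real.sqrt_eq_rpow, ← ENNReal.ofReal_rpow_of_nonneg h0 (by norm_num),
    ofReal_integral_eq_lintegral_ofReal hInt
      (Filter.Eventually.of_forall fun q => mul_nonneg (hw q) (by positivity))]
  congr 1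
  refine lintegral_congr fun q => ?_
  rw [ENNReal.ofReal_mul (hw q), ofReal_wgt_zero, mul_pow, airyWt_sq, ENNReal.ofReal_pow
    (norm_nonneg _), ofReal_norm, mul_comm]

theorem ofReal_XnormM_le {s β : ℝ} {k : ℕ} {M : (Fin k → ℝ) → ℂ} {u : Fin k → ℝ × ℝ → ℂ}
    {T : ℝ × ℝ → ℝ≥0∞} {A : ℝ≥0∞} (hT : ∀ q : ℝ × ℝ,
      ENNReal.ofReal (wgt s β q.1 q.2) * ‖convFT k M u q.1 q.2‖ₑ ^ 2 ≤ T q ^ 2)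
    (hA : ∫⁻ q, T q ^ 2 ≤ A ^ 2) : ENNReal.ofReal (XnormM s β k M u) ≤ A := by
  have hw : ∀ q : ℝ × ℝ, 0 ≤ wgt s β q.1 q.2 := fun q => by unfold wgt; positivity
  have h0 : 0 ≤ ∫ q : ℝ × ℝ, wgt s β q.1 q.2 * ‖convFT k M u q.1 q.2‖ ^ 2 :=
    integral_nonneg fun q => mul_nonneg (hw q) (by positivity)
  rw [XnormM, Real.sqrt_eq_rpow, ← ENNReal.ofReal_rpow_of_nonneg h0 (by norm_num)]
  calc _ ≤ (A ^ 2) ^ (1 / 2 : ℝ) := by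
        gcongr
        refine le_trans ?_ hA
        rw [← Real.enorm_of_nonneg h0]
        refine (enorm_integral_le_lintegral_enorm _).trans (lintegral_mono fun q => ?_)
        refine le_trans (le_of_eq ?_) (hT q)
        rw [Real.enorm_of_nonneg (mul_nonneg (hw q) (by positivity)), ENNReal.ofReal_mul (hw q),
          ENNReal.ofReal_pow (norm_nonneg _), ofReal_norm]
    _ = A := by rw [← ENNReal.rpow_natCast, ← ENNReal.rpow_mul]; norm_num

/-- Extend `n` points by a last one so that the total is `q`. -/
def snocTot {n : ℕ} (q : ℝ × ℝ) (y : Fin n → ℝ × ℝ) : Fin (n + 1) → ℝ × ℝ :=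
  Fin.snoc y (q - ∑ i, y i)

theorem measurable_fin_snoc {α : Type*} [MeasurableSpace α] {n : ℕ} :
    Measurable fun z : (Fin n → α) × α => (Fin.snoc z.1 z.2 : Fin (n + 1) → α) := by
  refine measurable_pi_iff.2 fun j => ?_
  refine Fin.lastCases ?_ (fun i => ?_) j
  · simpa using measurable_snd
  · simp only [Fin.snoc_castSucc]
    exact (measurable_pi_apply i).comp measurable_fst

theorem measurable_snocTot {n : ℕ} :
    Measurable fun z : (ℝ × ℝ) × (Fin n → ℝ × ℝ) => snocTot z.1 z.2 := by
  have : Measurable fun z : (ℝ × ℝ) × (Fin n → ℝ × ℝ) => (z.2, z.1 - ∑ i, z.2 i) := by fun_prop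
  exact measurable_fin_snoc.comp this

theorem padTot_snd (q : ℝ × ℝ) (y : Fin 3 → ℝ × ℝ) (j : Fin 4) :
    padTot 4 q.2 (fun i => (y i).2) j = (snocTot q y j).2 := by
  refine Fin.lastCases ?_ (fun i => ?_) j
  · rw [snocTot, Fin.snoc_last]
    simp [padTot, Prod.snd_sum]
  · simp [padTot, snocTot]

theorem padTot_fst (q : ℝ × ℝ) (y : Fin 3 → ℝ × ℝ) (j : Fin 4) :
    padTot 4 q.1 (fun i => (y i).1) j = (snocTot q y j).1 := by
  refine Fin.lastCases ?_ (fun i => ?_) j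
  · rw [snocTot, Fin.snoc_last]
    simp [padTot, Prod.fst_sum]
  · simp [padTot, snocTot]

theorem lintegral_lintegral_snocTot {n : ℕ} {g : ℝ × ℝ → ℝ≥0∞} {H : (Fin (n + 1) → ℝ × ℝ) → ℝ≥0∞}
    (hg : Measurable g) (hH : Measurable H) :
    ∫⁻ q, (∫⁻ y : Fin n → ℝ × ℝ, H (snocTot q y)) * g q = ∫⁻ z, H z * g (∑ j, z j) := by
  have hm : Measurable fun z : (ℝ × ℝ) × (Fin n → ℝ × ℝ) => H (snocTot z.1 z.2) :=
    hH.comp measurable_snocTot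
  have hHg : Measurable fun z : Fin (n + 1) → ℝ × ℝ => H z * g (∑ j, z j) :=
    hH.mul (hg.comp (by fun_prop))
  calc _ = ∫⁻ q, ∫⁻ y : Fin n → ℝ × ℝ, H (snocTot q y) * g q :=
        lintegral_congr fun q => (lintegral_mul_const _ (hm.comp measurable_prodMk_left)).symm
    _ = ∫⁻ y : Fin n → ℝ × ℝ, ∫⁻ q, H (snocTot q y) * g q :=
        lintegral_lintegral_swap (hm.mul (hg.comp measurable_fst)).aemeasurable
    _ = ∫⁻ y : Fin n → ℝ × ℝ, ∫⁻ x, H (Fin.snoc y x) * g (∑ j, y j + x) := by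
        refine lintegral_congr fun y => ?_
        rw [← lintegral_add_left_eq_self _ (∑ j, y j)]
        simp [snocTot]
    _ = _ := by
        rw [lintegral_fin_snoc hHg]
        simp [Fin.sum_univ_castSucc]

theorem XnormM_highSymbol_le {s N b b' : ℝ} {A : ℝ≥0∞} (hb1 : b ≤ 1)
    (hA : ∀ (g : ℝ × ℝ → ℝ≥0∞) (F : Fin 4 → ℝ × ℝ → ℝ≥0∞), Measurable g →
      (∀ j, Measurable (F j)) →
      ∫⁻ q : Fin 4 → ℝ × ℝ, ‖highSymbol s N fun j => (q j).2‖ₑ *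
        (g (∑ j, q j) * airyWt (b' / 2) (∑ j, q j) *
          ∏ j, (F j (q j) * airyWt (-b / 2) (q j))) ≤
        A * (∫⁻ q, g q ^ 2) ^ (1 / 2 : ℝ) * ∏ j, (∫⁻ q, F j q ^ 2) ^ (1 / 2 : ℝ))
    (v : Fin 4 → SchwartzMap (ℝ × ℝ) ℂ) :
    ENNReal.ofReal (XnormM 0 b' 4 (highSymbol s N) fun j => ⇑(v j)) ≤
      A * ∏ j, ENNReal.ofReal (Xnorm 0 b ⇑(v j)) := by
  have hG : ∀ j, Measurable fun q : ℝ × ℝ => ‖FT2 (v j) q.1 q.2‖ₑ := fun j => by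
    obtain ⟨S, hS⟩ := exists_schwartz_eq_FT2 (v j)
    simp only [← hS]
    exact S.continuous.measurable.enorm
  set H : (Fin 4 → ℝ × ℝ) → ℝ≥0∞ := fun z =>
    ‖highSymbol s N fun j => (z j).2‖ₑ * ∏ j, ‖FT2 (v j) (z j).1 (z j).2‖ₑ with hH
  have hHm : Measurable H := by
    refine Measurable.mul ((measurable_highSymbol s N).comp (by fun_prop)).enorm ?_
    exact Finset.measurable_fun_prod _ fun j _ => (hG j).comp (measurable_pi_apply j)
  refine ofReal_XnormM_le
    (T := fun q => airyWt (b' / 2) q * ∫⁻ y : Fin 3 → ℝ × ℝ, H (snocTot q y)) (fun q => ?_) ?_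
  · rw [mul_pow, airyWt_sq, ofReal_wgt_zero]
    gcongr
    refine (enorm_integral_le_lintegral_enorm _).trans (le_of_eq ?_)
    refine lintegral_congr fun y => ?_
    have h2 : (padTot 4 q.2 fun i => (y i).2) = fun j => (snocTot q y j).2 :=
      funext fun j => padTot_snd q y j
    have h1 : (padTot 4 q.1 fun i => (y i).1) = fun j => (snocTot q y j).1 :=
      funext fun j => padTot_fst q y j
    rw [hH, h1, h2, enorm_mul]
    simp only [enorm_eq_nnnorm, nnnorm_prod, ENNReal.ofNNReal_finsetProd]
  · refine lintegral_sq_le_of_forall_lintegral_mul_le fun g hg => ?_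
    have h := hA g (fun j q => ‖FT2 (v j) q.1 q.2‖ₑ * airyWt (b / 2) q) hg
      fun j => (hG j).mul (measurable_airyWt _)
    simp only [lintegral_airyWt_mul_sq_eq_Xnorm hb1] at h
    rw [mul_right_comm] at h
    refine le_trans (le_of_eq ?_) h
    have hcancel : ∀ q, airyWt (b / 2) q * airyWt (-b / 2) q = 1 := fun q => by
      rw [airyWt, airyWt, jb_mul, neg_div, add_neg_cancel, jb, Real.rpow_zero, ENNReal.ofReal_one]
    calc _ = ∫⁻ q, (∫⁻ y : Fin 3 → ℝ × ℝ, H (snocTot q y)) * (g q * airyWt (b' / 2) q) :=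
          lintegral_congr fun q => by ring
      _ = _ := lintegral_lintegral_snocTot (hg.mul (measurable_airyWt _)) hHm
      _ = _ := by
          refine lintegral_congr fun z => ?_
          simp only [mul_assoc, hcancel, mul_one, hH]
          ring

theorem D1_second_estimate (s : ℝ) (hs : -1/6 < s) (hs0 : s < 0) :
    ∃ ε₀ > 0, ∀ ε : ℝ, 0 < ε → ε < ε₀ →
      ∃ b b' C : ℝ, 1/2 < b ∧ b < 1 ∧ b - 1 < b' ∧ b' < 0 ∧ 0 < C ∧
        ∀ N : ℝ, 1 ≤ N → ∀ v : Fin 4 → SchwartzMap (ℝ × ℝ) ℂ,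
          XnormM 0 b' 4
              (fun ξ => if N < max (max (max |ξ 0| |ξ 1|) |ξ 2|) |ξ 3| then
                (((ξ 0 + ξ 1 + ξ 2 + ξ 3) * mI s N (ξ 0 + ξ 1 + ξ 2 + ξ 3) /
                  (mI s N (ξ 0) * mI s N (ξ 1) * mI s N (ξ 2) * mI s N (ξ 3)) : ℝ) : ℂ)
                else 0)
              (fun j => ⇑(v j)) ≤
            C * N ^ (-(1:ℝ)/2 + ε) * ∏ j, Xnorm 0 b ⇑(v j) := by
  refine ⟨1, one_pos, fun ε hε _ => ?_⟩
  obtain ⟨b, b', hb, hb1, hbb, hb', C, hC, h⟩ := exists_dual_quadrilinear_bound hs hs0 hε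
  refine ⟨b, b', C.toReal + 1, hb, hb1, hbb, hb', by positivity, fun N hN v => ?_⟩
  have hN0 : 0 < N := by linarith
  have hX : ∀ j, 0 ≤ Xnorm 0 b (v j) := fun j => Real.sqrt_nonneg _
  have hP : 0 ≤ ∏ j, Xnorm 0 b (v j) := Finset.prod_nonneg fun j _ => hX j
  have hXM := XnormM_highSymbol_le (A := C * ENNReal.ofReal (N ^ (-(1 : ℝ) / 2 + ε))) hb1.le
    (fun g F hg hF => h N hN g F hg hF) v
  rw [← ENNReal.ofReal_toReal hC, ← ENNReal.ofReal_mul ENNReal.toReal_nonneg,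
    ← ENNReal.ofReal_prod_of_nonneg fun j _ => hX j, ← ENNReal.ofReal_mul (by positivity),
    ENNReal.ofReal_le_ofReal_iff (by positivity)] at hXM
  refine hXM.trans ?_
  gcongr
  linarith
end
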